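/- arXiv:2601.16450 — 3 statements merged into one kernel-verified Lean document; each statement's English description precedes it below -/
import Mathlib

section
/- For any x ∈ 𝔽̄, any z ∈ {0, +∞, −∞, NaN} ∪ ({±2^e : e ∈ ℤ} ∩ 𝔽), and any n, m ∈ ℕ∪{0}, it holds that z ⊕ ⊕_{i=1}^{6·2^p+n} x = z ⊕ ⊕_{i=1}^{6·2^p+m} x, where all sums are left-associative (z added first). -/
open scoped Classical

namespace FPT

noncomputable section

/-- Minimal exponent `𝔢_min = -2^(q-1) + 2`. -/
def emin (q : ℕ) : ℤ := -(2 ^ (q - 1) : ℤ) + 2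

/-- Maximal exponent `𝔢_max = 2^(q-1) - 1`. -/
def emax (q : ℕ) : ℤ := (2 ^ (q - 1) : ℤ) - 1

/-- The set of finite floating-point numbers with `p` mantissa bits and exponent bits `q`:
normal numbers `±(1.m₁⋯m_p)·2^e = m·2^(e-p)` with `2^p ≤ |m| ≤ 2^(p+1)-1` and
`emin ≤ e ≤ emax`, together with subnormal numbers `±(0.m₁⋯m_p)·2^emin = m·2^(emin-p)`
with `|m| ≤ 2^p - 1`. -/
def Fset (p q : ℕ) : Set ℝ :=
  {x | ∃ m e : ℤ, |m| ≤ 2 ^ (p + 1) - 1 ∧ emin q ≤ e ∧ e ≤ emax q ∧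
      ((2 : ℤ) ^ p ≤ |m| ∨ e = emin q) ∧ x = (m : ℝ) * (2 : ℝ) ^ (e - (p : ℤ))}

/-- The largest positive float `Ω = (2 - 2^(-p))·2^emax`. -/
def Omega (p q : ℕ) : ℝ := (2 - (2 : ℝ) ^ (-(p : ℤ))) * (2 : ℝ) ^ (emax q)

/-- Overflow threshold `Ω + 2^(emax - p - 1)`. -/
def thr (p q : ℕ) : ℝ := Omega p q + (2 : ℝ) ^ (emax q - (p : ℤ) - 1)

/-- `y` is a float whose last mantissa bit `m_p` is zero, i.e. `y = m·2^(e-p)` with `m` even. -/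
def EvenMantissa (p q : ℕ) (y : ℝ) : Prop :=
  ∃ m e : ℤ, |m| ≤ 2 ^ (p + 1) - 1 ∧ emin q ≤ e ∧ e ≤ emax q ∧
    ((2 : ℤ) ^ p ≤ |m| ∨ e = emin q) ∧ y = (m : ℝ) * (2 : ℝ) ^ (e - (p : ℤ)) ∧ 2 ∣ m

/-- `RoundsTo p q x y` : `y` is the rounding of `x` to the nearest float, ties to even. -/
def RoundsTo (p q : ℕ) (x y : ℝ) : Prop :=
  y ∈ Fset p q ∧ (∀ z ∈ Fset p q, |x - y| ≤ |x - z|) ∧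
    ((∀ z ∈ Fset p q, |x - z| = |x - y| → z = y) ∨ EvenMantissa p q y)

/-- Extended floats `𝔽̄ = 𝔽 ∪ {-∞, +∞, NaN}` (the payload of `fin` is meant to lie in `Fset`). -/
inductive EF where
  | fin : ℝ → EF
  | pinf : EF
  | ninf : EF
  | nan : EF

/-- Rounding `⌊·⌉ : ℝ → 𝔽̄`. -/
def rnd (p q : ℕ) (x : ℝ) : EF :=
  if thr p q ≤ x then .pinf
  else if x ≤ -thr p q then .ninf
  else .fin (Classical.epsilon (RoundsTo p q x))

/-- Floating-point addition `⊕`. -/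
def fadd (p q : ℕ) : EF → EF → EF
  | .nan, _ => .nan
  | _, .nan => .nan
  | .fin x, .fin y => rnd p q (x + y)
  | .fin _, .pinf => .pinf
  | .fin _, .ninf => .ninf
  | .pinf, .fin _ => .pinf
  | .ninf, .fin _ => .ninf
  | .pinf, .pinf => .pinf
  | .ninf, .ninf => .ninf
  | .pinf, .ninf => .nan
  | .ninf, .pinf => .nan

/-- Floating-point multiplication `⊗`. -/
def fmul (p q : ℕ) : EF → EF → EF
  | .nan, _ => .nan
  | _, .nan => .nan
  | .fin x, .fin y => rnd p q (x * y)
  | .fin x, .pinf => if 0 < x then .pinf else if x < 0 then .ninf else .nan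
  | .fin x, .ninf => if 0 < x then .ninf else if x < 0 then .pinf else .nan
  | .pinf, .fin y => if 0 < y then .pinf else if y < 0 then .ninf else .nan
  | .ninf, .fin y => if 0 < y then .ninf else if y < 0 then .pinf else .nan
  | .pinf, .pinf => .pinf
  | .ninf, .ninf => .pinf
  | .pinf, .ninf => .ninf
  | .ninf, .pinf => .ninf

/-- Floating-point subtraction `x ⊖ y = x ⊕ ((-1) ⊗ y)`. -/
def fsub (p q : ℕ) (x y : EF) : EF := fadd p q x (fmul p q (.fin (-1)) y)

/-- Floating-point division (defined for `0 ≤ x ≤ y < ∞`, `y > 0`; NaN propagates). -/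
def fdiv (p q : ℕ) : EF → EF → EF
  | _, .nan => .nan
  | .nan, _ => .nan
  | .fin x, .fin y => if 0 < y then rnd p q (x / y) else .nan
  | _, _ => .nan

/-- Correctly rounded exponential `⌊exp⌉`. -/
def fexp (p q : ℕ) : EF → EF
  | .fin x => rnd p q (Real.exp x)
  | .pinf => .pinf
  | .ninf => .fin 0
  | .nan => .nan

/-- Correctly rounded ReLU `ρ = ⌊ReLU⌉`. -/
def frelu (p q : ℕ) : EF → EF
  | .fin x => rnd p q (max x 0)
  | .pinf => .pinf
  | .ninf => .fin 0
  | .nan => .nan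

/-- Left-associative floating-point sum of a list (empty sum is `0`). -/
def fsuml (p q : ℕ) : List EF → EF
  | [] => .fin 0
  | x :: xs => xs.foldl (fadd p q) x

/-- Left-associative floating-point sum `⊕_{i=1}^{n} v i` over `Fin n`. -/
def fsum (p q : ℕ) {n : ℕ} (v : Fin n → EF) : EF := fsuml p q ((List.finRange n).map v)

/-- Matrices of extended floats. -/
abbrev Mat (a b : ℕ) := Fin a → Fin b → EF

/-- Entrywise floating-point matrix addition. -/
def madd (p q : ℕ) {a b : ℕ} (M N : Mat a b) : Mat a b := fun i j => fadd p q (M i j) (N i j)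

/-- Floating-point matrix multiplication with left-associative inner sums. -/
def mmul (p q : ℕ) {a b c : ℕ} (M : Mat a b) (N : Mat b c) : Mat a c :=
  fun i k => fsum p q (fun j => fmul p q (M i j) (N j k))

/-- Maximum of two extended floats (NaN-propagating). -/
def emax2 : EF → EF → EF
  | .nan, _ => .nan
  | _, .nan => .nan
  | .pinf, _ => .pinf
  | _, .pinf => .pinf
  | .fin x, .fin y => .fin (max x y)
  | .fin x, .ninf => .fin x
  | .ninf, y => y

/-- Maximum entry of a vector of extended floats. -/
def vmax {n : ℕ} (v : Fin n → EF) : EF := ((List.finRange n).map v).foldl emax2 .ninf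

/-- Floating-point softmax `σ(x)_i = ⌊exp⌉(x_i ⊖ x_*) ⊘ (⊕_j ⌊exp⌉(x_j ⊖ x_*))`. -/
def fsoftmax (p q : ℕ) {n : ℕ} (v : Fin n → EF) : Fin n → EF := fun i =>
  fdiv p q (fexp p q (fsub p q (v i) (vmax v)))
    (fsum p q (fun j => fexp p q (fsub p q (v j) (vmax v))))

/-- Column-wise application of the floating-point softmax. -/
def colSoftmax (p q : ℕ) {k n : ℕ} (A : Mat k n) : Mat k n :=
  fun i j => fsoftmax p q (fun i' => A i' j) i

/-- The extended float is a finite float in `𝔽`. -/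
def EF.IsF (p q : ℕ) : EF → Prop
  | .fin x => x ∈ Fset p q
  | _ => False

/-- The extended float is a well-formed element of `𝔽̄`. -/
def EF.Valid (p q : ℕ) : EF → Prop
  | .fin x => x ∈ Fset p q
  | _ => True

/-- The extended float is finite (not `±∞` or NaN). -/
def EF.Finite : EF → Prop
  | .fin _ => True
  | _ => False

/-- All entries of a vector are finite floats. -/
def VecFin (p q : ℕ) {a : ℕ} (v : Fin a → EF) : Prop := ∀ i, (v i).IsF p q

/-- All entries of a matrix are finite floats. -/
def MatFin (p q : ℕ) {a b : ℕ} (M : Mat a b) : Prop := ∀ i j, (M i j).IsF p q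

/-- Embed a real matrix as a matrix of extended floats. -/
def toEF {a b : ℕ} (M : Fin a → Fin b → ℝ) : Mat a b := fun i j => .fin (M i j)

/-- Parameters of one transformer block (attention layer followed by feed-forward layer)
with `h` heads, head dimension `m`, feed-forward width `r`, hidden dimension `d`. -/
structure Block (h m r d : ℕ) where
  WK : Fin h → Fin m → Fin d → ℝ
  WQ : Fin h → Fin m → Fin d → ℝ
  WV : Fin h → Fin m → Fin d → ℝ
  WO : Fin h → Fin d → Fin m → ℝ
  W1 : Fin r → Fin d → ℝ
  W2 : Fin d → Fin r → ℝ
  b1 : Fin r → ℝ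
  b2 : Fin d → ℝ

/-- All parameters of the block are floats. -/
def Block.Valid (p q : ℕ) {h m r d : ℕ} (B : Block h m r d) : Prop :=
  (∀ i a b, B.WK i a b ∈ Fset p q) ∧ (∀ i a b, B.WQ i a b ∈ Fset p q) ∧
    (∀ i a b, B.WV i a b ∈ Fset p q) ∧ (∀ i a b, B.WO i a b ∈ Fset p q) ∧
    (∀ a b, B.W1 a b ∈ Fset p q) ∧ (∀ a b, B.W2 a b ∈ Fset p q) ∧
    (∀ a, B.b1 a ∈ Fset p q) ∧ (∀ a, B.b2 a ∈ Fset p q)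

/-- The attention layer
`AT(X) = X ⊕ (⊕_i W_i^O ⊗ ((W_i^V ⊗ X) ⊗ σ((W_i^K ⊗ X)ᵀ ⊗ (W_i^Q ⊗ X))))`. -/
def attnApply (p q : ℕ) {h m r d : ℕ} (B : Block h m r d) {n : ℕ} (X : Mat d n) : Mat d n :=
  madd p q X (fun a b =>
    fsum p q (fun i =>
      (mmul p q (toEF (B.WO i))
        (mmul p q (mmul p q (toEF (B.WV i)) X)
          (colSoftmax p q
            (mmul p q (fun u v => mmul p q (toEF (B.WK i)) X v u)
              (mmul p q (toEF (B.WQ i)) X))))) a b))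

/-- The feed-forward layer `FF(X) = X ⊕ (W₂ ⊗ ρ(W₁ ⊗ X ⊕ b₁1ᵀ) ⊕ b₂1ᵀ)`. -/
def ffApply (p q : ℕ) {h m r d : ℕ} (B : Block h m r d) {n : ℕ} (X : Mat d n) : Mat d n :=
  madd p q X
    (madd p q
      (mmul p q (toEF B.W2)
        (fun i j => frelu p q
          ((madd p q (mmul p q (toEF B.W1) X) (fun a _ => .fin (B.b1 a))) i j)))
      (fun a _ => .fin (B.b2 a)))

/-- One transformer block: `FF ∘ AT`. -/
def Block.apply (p q : ℕ) {h m r d n : ℕ} (B : Block h m r d) (X : Mat d n) : Mat d n :=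
  ffApply p q B (attnApply p q B X)

/-- Composition of a list of transformer blocks (applied from left to right). -/
def blocksApply (p q : ℕ) {h m r d n : ℕ} (L : List (Block h m r d)) (X : Mat d n) : Mat d n :=
  L.foldl (fun Y B => Block.apply p q B Y) X

/-- `f` is a floating-point transformer:
`f(X) = W_out ⊗ g(W_in ⊗ X ⊕ b_in 1ᵀ) ⊕ b_out 1ᵀ` with `g` a nonempty composition of
transformer blocks and all parameters finite floats. -/
def IsTransformer (p q din dout n : ℕ) (f : Mat din n → Mat dout n) : Prop :=
  ∃ (h m r d : ℕ) (L : List (Block h m r d)) (Win : Fin d → Fin din → ℝ) (bin : Fin d → ℝ)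
      (Wout : Fin dout → Fin d → ℝ) (bout : Fin dout → ℝ),
    0 < h ∧ 0 < m ∧ 0 < r ∧ 0 < d ∧ L ≠ [] ∧ (∀ B ∈ L, B.Valid p q) ∧
      (∀ i j, Win i j ∈ Fset p q) ∧ (∀ i, bin i ∈ Fset p q) ∧
      (∀ i j, Wout i j ∈ Fset p q) ∧ (∀ i, bout i ∈ Fset p q) ∧
      ∀ X : Mat din n,
        f X = madd p q
          (mmul p q (toEF Wout)
            (blocksApply p q L
              (madd p q (mmul p q (toEF Win) X) (fun i _ => .fin (bin i)))))
          (fun i _ => .fin (bout i))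

/-- Column permutation: column `j` of `permCols π X` is column `π j` of `X`. -/
def permCols {a n : ℕ} (π : Equiv.Perm (Fin n)) (X : Mat a n) : Mat a n := fun i j => X i (π j)

/-- The transposition `π_{(1,2)}^n` of the first two coordinates. -/
def swap12 (n : ℕ) (hn : 2 ≤ n) : Equiv.Perm (Fin n) :=
  Equiv.swap ⟨0, by omega⟩ ⟨1, by omega⟩

/-- The columns of `X` are pairwise distinct. -/
def DistinctCols {a n : ℕ} (X : Mat a n) : Prop :=
  ∀ j k : Fin n, j ≠ k → ∃ i, X i j ≠ X i k

/-- `(α,β)`-similarity (with 1-based column index `i = j+1`). -/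
def Similar {a n : ℕ} (α β : ℕ) (X Y : Mat a n) : Prop :=
  ∃ z1 z2 : Fin a → EF,
    (∀ j : Fin n, (j : ℕ) + 1 ≤ α → ∀ i, X i j = z1 i) ∧
    (∀ j : Fin n, α < (j : ℕ) + 1 → (j : ℕ) + 1 ≤ β → ∀ i, X i j = z2 i) ∧
    (∀ j : Fin n, (j : ℕ) + 1 < α → ∀ i, Y i j = z1 i) ∧
    (∀ j : Fin n, α ≤ (j : ℕ) + 1 → (j : ℕ) + 1 ≤ β → ∀ i, Y i j = z2 i) ∧
    (∀ j : Fin n, β < (j : ℕ) + 1 → ∀ i, X i j = Y i j)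

/-- The smallest float strictly greater than `x` (junk value if none exists). -/
def succF (p q : ℕ) (x : ℝ) : ℝ := sInf {y | y ∈ Fset p q ∧ x < y}

/-- Successor on extended floats: the smallest element of `𝔽 ∪ {+∞}` strictly above. -/
def succEF (p q : ℕ) : EF → EF
  | .fin r => if ∃ y ∈ Fset p q, r < y then .fin (succF p q r) else .pinf
  | e => e

/-- Floating-point affine transformation `φ(x) = W ⊗ x ⊕ b`. -/
def affApply (p q : ℕ) {a b : ℕ} (W : Fin b → Fin a → ℝ) (c : ℝ) (v : Fin a → EF) :
    Fin b → EF :=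
  fun i => fadd p q (fsum p q (fun j => fmul p q (.fin (W i j)) (v j))) (.fin c)

/-- All intermediate values of `φ(x) = W ⊗ x ⊕ b` on input `v`, including every
left-associative partial sum of the matrix–vector product, are finite. -/
def AffIntermFin (p q : ℕ) {a b : ℕ} (W : Fin b → Fin a → ℝ) (c : ℝ) (v : Fin a → EF) : Prop :=
  ∀ i : Fin b,
    (∀ k : ℕ,
      (fsuml p q (((List.finRange a).take k).map
        (fun j => fmul p q (.fin (W i j)) (v j)))).Finite) ∧
    (affApply p q W c v i).Finite

end
end FPT

namespace FPT

section Floats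

variable {p q : ℕ}

lemma two_zpow_pos (k : ℤ) : (0 : ℝ) < 2 ^ k := by positivity

lemma two_zpow_mono {i j : ℤ} (h : i ≤ j) : (2 : ℝ) ^ i ≤ 2 ^ j :=
  zpow_le_zpow_right₀ (by norm_num) h

lemma two_zpow_eq_natPow_mul (k : ℤ) (n : ℕ) : (2 : ℝ) ^ (k + n) = 2 ^ n * 2 ^ k := by
  rw [zpow_add₀ (by norm_num), zpow_natCast, mul_comm]

lemma neg_mem_Fset {y : ℝ} (hy : y ∈ Fset p q) : -y ∈ Fset p q := by
  obtain ⟨m, e, h1, h2, h3, h4, rfl⟩ := hy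
  exact ⟨-m, e, by rwa [abs_neg], h2, h3, by rwa [abs_neg], by push_cast; ring⟩

lemma zero_mem_Fset (hE : emin q ≤ emax q) : (0 : ℝ) ∈ Fset p q := by
  refine ⟨0, emin q, ?_, le_rfl, hE, Or.inr rfl, by simp⟩
  have : (1 : ℤ) ≤ 2 ^ (p + 1) := one_le_pow₀ (by norm_num)
  simpa using this

lemma EvenMantissa.neg {y : ℝ} (hy : EvenMantissa p q y) : EvenMantissa p q (-y) := by
  obtain ⟨m, e, h1, h2, h3, h4, rfl, h5⟩ := hy
  exact ⟨-m, e, by rwa [abs_neg], h2, h3, by rwa [abs_neg], by push_cast; ring,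
    (dvd_neg).2 h5⟩

lemma Omega_eq (p q : ℕ) : Omega p q = (2 ^ (p + 1) - 1) * 2 ^ (emax q - p) := by
  have h : (2 : ℝ) ^ emax q = 2 ^ p * 2 ^ (emax q - p) := by
    rw [← two_zpow_eq_natPow_mul]; congr 1; ring
  rw [Omega, h, zpow_neg, zpow_natCast]
  field_simp
  ring

lemma thr_eq (p q : ℕ) : thr p q = (2 ^ (p + 1) - 1 / 2) * 2 ^ (emax q - p) := by
  rw [thr, Omega_eq, zpow_sub_one₀ (by norm_num)]
  ring

lemma two_zpow_emax_eq (p q : ℕ) : (2 : ℝ) ^ (emax q + 1) = 2 ^ (p + 1) * 2 ^ (emax q - p) := by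
  rw [← two_zpow_eq_natPow_mul]; congr 1; push_cast; ring

lemma thr_le_two_zpow (p q : ℕ) : thr p q ≤ 2 ^ (emax q + 1) := by
  rw [thr_eq, two_zpow_emax_eq p]
  exact mul_le_mul_of_nonneg_right (by norm_num) (two_zpow_pos _).le

lemma Omega_lt_thr (p q : ℕ) : Omega p q < thr p q := lt_add_of_pos_right _ (two_zpow_pos _)

lemma abs_mul_two_zpow_le {m : ℤ} (hm : |m| ≤ 2 ^ (p + 1) - 1) (e : ℤ) :
    |(m : ℝ) * 2 ^ (e - p)| ≤ (2 ^ (p + 1) - 1) * 2 ^ (e - p) := by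
  rw [abs_mul, abs_of_pos (two_zpow_pos _)]
  have : (|m| : ℝ) ≤ 2 ^ (p + 1) - 1 := by exact_mod_cast hm
  exact mul_le_mul_of_nonneg_right this (two_zpow_pos _).le

lemma abs_le_Omega {y : ℝ} (hy : y ∈ Fset p q) : |y| ≤ Omega p q := by
  obtain ⟨m, e, h1, h2, h3, h4, rfl⟩ := hy
  refine (abs_mul_two_zpow_le h1 e).trans ?_
  rw [Omega_eq]
  refine mul_le_mul_of_nonneg_left (two_zpow_mono (by omega)) ?_
  have : (1 : ℝ) ≤ 2 ^ (p + 1) := one_le_pow₀ (by norm_num)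
  linarith

lemma abs_lt_thr {y : ℝ} (hy : y ∈ Fset p q) : |y| < thr p q :=
  (abs_le_Omega hy).trans_lt (Omega_lt_thr p q)

lemma thr_pos (hE : emin q ≤ emax q) : 0 < thr p q := by
  simpa using abs_lt_thr (p := p) (zero_mem_Fset hE)

lemma exists_eq_mul_of_le_exponent (m : ℤ) {i k : ℤ} (h : i ≤ k) :
    ∃ n : ℤ, (m : ℝ) * 2 ^ k = n * 2 ^ i := by
  obtain ⟨d, rfl⟩ := Int.le.dest h
  exact ⟨m * 2 ^ d, by rw [two_zpow_eq_natPow_mul]; push_cast; ring⟩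

/-- Every float is a multiple of the smallest positive float. -/
lemma exists_eq_mul_min {y : ℝ} (hy : y ∈ Fset p q) :
    ∃ n : ℤ, y = n * 2 ^ (emin q - p) := by
  obtain ⟨m, e, h1, h2, h3, h4, rfl⟩ := hy
  exact exists_eq_mul_of_le_exponent m (by omega)

/-- A float of absolute value at least `2 ^ (i + p)` is a multiple of `2 ^ i`. -/
lemma exists_eq_mul_of_le_abs {y : ℝ} (hy : y ∈ Fset p q) {i : ℤ}
    (h : (2 : ℝ) ^ (i + p) ≤ |y|) : ∃ n : ℤ, y = n * 2 ^ i := by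
  obtain ⟨m, e, h1, h2, h3, h4, rfl⟩ := hy
  refine exists_eq_mul_of_le_exponent m ?_
  have h5 := h.trans (abs_mul_two_zpow_le h1 e)
  have h6 : (2 ^ (p + 1) - 1) * (2 : ℝ) ^ (e - p) < 2 ^ (e + 1) := by
    have : (2 : ℝ) ^ (e + 1) = 2 ^ (p + 1) * 2 ^ (e - p) := by
      rw [← two_zpow_eq_natPow_mul]; congr 1; push_cast; ring
    rw [this]
    exact mul_lt_mul_of_pos_right (by linarith) (two_zpow_pos _)
  have h7 := (zpow_lt_zpow_iff_right₀ (by norm_num : (1 : ℝ) < 2)).1 (h5.trans_lt h6)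
  omega

lemma add_le_of_mul_lt {a b : ℤ} {u : ℝ} (hu : 0 < u) (h : a * u < b * u) :
    a * u + u ≤ b * u := by
  have h1 : a < b := by exact_mod_cast lt_of_mul_lt_mul_right h hu.le
  have h2 : (a : ℝ) + 1 ≤ b := by exact_mod_cast h1
  nlinarith

/-- Consecutive floats above a float `s ≥ 2 ^ (i + p)` or `s < - 2 ^ (i + p)` are at least
`2 ^ i` apart. -/
lemma add_le_of_lt {s y : ℝ} (hs : s ∈ Fset p q) (hy : y ∈ Fset p q) {i : ℤ}
    (h : (2 : ℝ) ^ (i + p) ≤ s ∨ s < -2 ^ (i + p)) (hsy : s < y) : s + 2 ^ i ≤ y := by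
  have hpos := two_zpow_pos (i + p)
  have hs' : (2 : ℝ) ^ (i + p) ≤ |s| := by
    rcases h with h | h
    · exact h.trans (le_abs_self s)
    · exact (lt_neg_of_lt_neg h).le.trans (neg_le_abs s)
  obtain ⟨a, ha⟩ := exists_eq_mul_of_le_abs hs hs'
  by_cases hy' : (2 : ℝ) ^ (i + p) ≤ |y|
  · obtain ⟨b, hb⟩ := exists_eq_mul_of_le_abs hy hy'
    rw [ha, hb] at hsy ⊢
    exact add_le_of_mul_lt (two_zpow_pos i) hsy
  · rw [not_le, abs_lt] at hy'
    rcases h with h | h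
    · linarith
    · have h1 : -(2 : ℝ) ^ (i + p) = ((-2 ^ p : ℤ) : ℝ) * 2 ^ i := by
        rw [two_zpow_eq_natPow_mul]; push_cast; ring
      rw [ha, h1] at h
      have h2 := add_le_of_mul_lt (two_zpow_pos i) h
      rw [← h1, ← ha] at h2
      linarith

/-- A number with at most `p + 1` significant bits is a float unless it overflows. -/
lemma mul_mem_Fset_or_le_abs (hE : emin q ≤ emax q) (d : ℕ) :
    ∀ N : ℤ, |N| ≤ 2 ^ (p + 1) → (N : ℝ) * 2 ^ (emin q - p + d) ∈ Fset p q ∨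
      (2 : ℝ) ^ (emax q + 1) ≤ |(N : ℝ) * 2 ^ (emin q - p + d)| := by
  have hlarge : ∀ (d : ℕ) (N : ℤ), |N| ≤ 2 ^ (p + 1) - 1 → 2 ^ p ≤ |N| →
      (N : ℝ) * 2 ^ (emin q - p + d) ∈ Fset p q ∨
      (2 : ℝ) ^ (emax q + 1) ≤ |(N : ℝ) * 2 ^ (emin q - p + d)| := by
    intro d N hN hN'
    by_cases he : emin q + d ≤ emax q
    · exact .inl ⟨N, emin q + d, hN, by omega, he, .inl hN', by congr 2; ring⟩
    · right
      rw [abs_mul, abs_of_pos (two_zpow_pos _)]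
      have h1 : (2 : ℝ) ^ p ≤ |(N : ℝ)| := by exact_mod_cast hN'
      calc (2 : ℝ) ^ (emax q + 1) ≤ 2 ^ (emin q - p + d + p) := two_zpow_mono (by omega)
        _ = 2 ^ p * 2 ^ (emin q - p + d) := two_zpow_eq_natPow_mul _ _
        _ ≤ _ := mul_le_mul_of_nonneg_right h1 (two_zpow_pos _).le
  have hpow : (2 : ℤ) ^ (p + 1) = 2 * 2 ^ p := by ring
  have hpos : (1 : ℤ) ≤ 2 ^ p := one_le_pow₀ (by norm_num)
  have hdouble : ∀ (d : ℕ) (M : ℤ), ((2 * M : ℤ) : ℝ) * 2 ^ (emin q - p + d)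
      = M * 2 ^ (emin q - p + (d + 1 : ℕ)) := by
    intro d M
    rw [two_zpow_eq_natPow_mul, two_zpow_eq_natPow_mul]; push_cast; ring
  have hcarry : ∀ (d : ℕ) (N : ℤ), |N| = 2 ^ (p + 1) →
      (N : ℝ) * 2 ^ (emin q - p + d) ∈ Fset p q ∨
      (2 : ℝ) ^ (emax q + 1) ≤ |(N : ℝ) * 2 ^ (emin q - p + d)| := by
    intro d N hN
    obtain ⟨M, rfl⟩ : (2 : ℤ) ∣ N := by
      rw [← dvd_abs, hN]; exact dvd_pow_self 2 (by omega)
    have hM : |M| = 2 ^ p := by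
      rw [abs_mul, abs_two] at hN; omega
    have := hlarge (d + 1) M (by omega) hM.ge
    rwa [← hdouble] at this
  induction d with
  | zero =>
    intro N hN
    rcases hN.lt_or_eq with hN | hN
    · exact .inl ⟨N, emin q, by omega, le_rfl, hE, .inr rfl, by simp⟩
    · exact hcarry 0 N hN
  | succ d ih =>
    intro N hN
    rcases hN.lt_or_eq with hN | hN
    · by_cases h : 2 ^ p ≤ |N|
      · exact hlarge _ N (by omega) h
      · have := ih (2 * N) (by rw [abs_mul, abs_two]; omega)
        rwa [hdouble] at this
    · exact hcarry _ N hN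

end Floats

section Rounding

variable {p q : ℕ}

lemma RoundsTo.neg {w y : ℝ} (h : RoundsTo p q w y) : RoundsTo p q (-w) (-y) := by
  obtain ⟨h1, h2, h3⟩ := h
  have habs : ∀ z : ℝ, |-w - z| = |w - -z| := fun z ↦ by
    rw [← abs_neg]; congr 1; ring
  refine ⟨neg_mem_Fset h1, fun z hz ↦ ?_, h3.imp (fun h z hz hzy ↦ ?_) EvenMantissa.neg⟩
  · rw [habs, habs, neg_neg]
    exact h2 _ (neg_mem_Fset hz)
  · rw [habs, habs, neg_neg] at hzy
    rw [← h _ (neg_mem_Fset hz) hzy, neg_neg]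

/-- Membership and parity for a normalized significand, allowing a carry to `2 ^ (p + 1)`. -/
lemma mem_Fset_of_normalized (hp : 0 < p) {m e : ℤ} (h0 : 0 ≤ m) (hm : m ≤ 2 ^ (p + 1))
    (h1 : emin q ≤ e) (h2 : e ≤ emax q) (h3 : 2 ^ p ≤ m ∨ e = emin q)
    (h4 : m = 2 ^ (p + 1) → e < emax q) :
    (m : ℝ) * 2 ^ (e - p) ∈ Fset p q ∧ (2 ∣ m → EvenMantissa p q ((m : ℝ) * 2 ^ (e - p))) := by
  have key : ∃ m' e' : ℤ, |m'| ≤ 2 ^ (p + 1) - 1 ∧ emin q ≤ e' ∧ e' ≤ emax q ∧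
      ((2 : ℤ) ^ p ≤ |m'| ∨ e' = emin q) ∧
      (m : ℝ) * 2 ^ (e - p) = (m' : ℝ) * (2 : ℝ) ^ (e' - (p : ℤ)) ∧ (2 ∣ m → 2 ∣ m') := by
    rcases hm.lt_or_eq with hm | hm
    · exact ⟨m, e, by rw [abs_of_nonneg h0]; omega, h1, h2, by rwa [abs_of_nonneg h0], rfl, id⟩
    · have hpos : (1 : ℤ) ≤ 2 ^ p := one_le_pow₀ (by norm_num)
      have hpow : (2 : ℤ) ^ (p + 1) = 2 * 2 ^ p := by ring
      refine ⟨2 ^ p, e + 1, ?_, by omega, h4 hm, .inl (le_abs_self _), ?_,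
        fun _ ↦ dvd_pow_self 2 hp.ne'⟩
      · rw [abs_of_nonneg (by omega)]; omega
      · have : e + 1 - (p : ℤ) = e - p + (1 : ℕ) := by push_cast; ring
        rw [this, two_zpow_eq_natPow_mul, hm]; push_cast; ring
  obtain ⟨m', e', k1, k2, k3, k4, k5, k6⟩ := key
  exact ⟨⟨m', e', k1, k2, k3, k4, k5⟩, fun hd ↦ ⟨m', e', k1, k2, k3, k4, k5, k6 hd⟩⟩

/-- Rounding a point lying between two neighbours `a ≤ w < b`. -/
lemma roundsTo_of_neighbours {w a b y : ℝ} (hab : ∀ z ∈ Fset p q, z ≤ a ∨ b ≤ z)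
    (haw : a ≤ w) (hwb : w < b)
    (hy : y ∈ Fset p q)
    (h : (y = a ∧ w - a < b - w) ∨ (y = b ∧ b - w < w - a) ∨
      ((y = a ∨ y = b) ∧ w - a = b - w ∧ EvenMantissa p q y)) : RoundsTo p q w y := by
  have ha := abs_of_nonneg (sub_nonneg.2 haw)
  have hb : |w - b| = b - w := by rw [abs_sub_comm, abs_of_pos (sub_pos.2 hwb)]
  have hz : ∀ z ∈ Fset p q, (z ≤ a ∧ |w - z| = w - z) ∨ (b ≤ z ∧ |w - z| = z - w) := by
    intro z hz
    rcases hab z hz with h | h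
    · exact .inl ⟨h, abs_of_nonneg (by linarith)⟩
    · exact .inr ⟨h, by rw [abs_sub_comm, abs_of_nonneg (by linarith)]⟩
  refine ⟨hy, fun z hzF ↦ ?_, ?_⟩
  · rcases h with ⟨rfl, h⟩ | ⟨rfl, h⟩ | ⟨rfl | rfl, h, -⟩ <;>
      rcases hz z hzF with ⟨h1, h2⟩ | ⟨h1, h2⟩ <;> linarith
  · rcases h with ⟨rfl, h⟩ | ⟨rfl, h⟩ | ⟨-, -, h⟩
    · left; intro z hzF hzy
      rcases hz z hzF with ⟨h1, h2⟩ | ⟨h1, h2⟩ <;> linarith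
    · left; intro z hzF hzy
      rcases hz z hzF with ⟨h1, h2⟩ | ⟨h1, h2⟩ <;> linarith
    · exact .inr h

lemma exists_exponent (hE : emin q ≤ emax q) {w : ℝ}
    (hw : w < 2 ^ (emax q + 1)) :
    ∃ e : ℤ, emin q ≤ e ∧ e ≤ emax q ∧ (2 ^ e ≤ w ∨ e = emin q) ∧ w < 2 ^ (e + 1) := by
  by_cases h : w < 2 ^ emin q
  · exact ⟨emin q, le_rfl, hE, .inr rfl, h.trans_le (two_zpow_mono (by omega))⟩
  · rw [not_lt] at h
    have hpos : 0 < w := (two_zpow_pos _).trans_le h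
    obtain ⟨e, h1, h2⟩ := exists_mem_Ico_zpow hpos (by norm_num : (1 : ℝ) < 2)
    have h3 := (zpow_lt_zpow_iff_right₀ (by norm_num : (1 : ℝ) < 2)).1 (h1.trans_lt hw)
    have h4 := (zpow_lt_zpow_iff_right₀ (by norm_num : (1 : ℝ) < 2)).1 (h.trans_lt h2)
    exact ⟨e, by omega, by omega, .inl h1, h2⟩

lemma exists_roundsTo_of_nonneg (hp : 0 < p) (hE : emin q ≤ emax q) {w : ℝ} (hw0 : 0 ≤ w)
    (hw : w < thr p q) : ∃ y, RoundsTo p q w y := by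
  obtain ⟨e, he1, he2, he3, he4⟩ :=
    exists_exponent hE (hw.trans_le (thr_le_two_zpow p q))
  set u : ℝ := 2 ^ (e - p) with hu
  have hupos : 0 < u := two_zpow_pos _
  have hue : (2 : ℝ) ^ e = 2 ^ p * u := by
    rw [hu, ← two_zpow_eq_natPow_mul]; congr 1; ring
  have hue' : (2 : ℝ) ^ (e + 1) = 2 ^ (p + 1) * u := by
    rw [hu, ← two_zpow_eq_natPow_mul]; congr 1; push_cast; ring
  set m : ℤ := ⌊w / u⌋ with hm
  have hmw : m * u ≤ w := (le_div_iff₀ hupos).1 (Int.floor_le _)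
  have hwm : w < (m + 1) * u := (div_lt_iff₀ hupos).1 (Int.lt_floor_add_one _)
  have hm0 : 0 ≤ m := Int.floor_nonneg.2 (by positivity)
  have hmlt : m < 2 ^ (p + 1) := by
    have : (m : ℝ) < 2 ^ (p + 1) :=
      lt_of_mul_lt_mul_right (hmw.trans_lt (he4.trans_eq hue')) hupos.le
    exact_mod_cast this
  have hmge : 2 ^ p ≤ m ∨ e = emin q := by
    refine he3.imp_left fun h ↦ Int.le_floor.2 ?_
    rw [le_div_iff₀ hupos]
    push_cast
    rwa [← hue]
  have hab : ∀ z ∈ Fset p q, z ≤ m * u ∨ (m + 1) * u ≤ z := by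
    intro z hz
    have hmult : (∃ n : ℤ, z = n * u) → z ≤ m * u ∨ (m + 1) * u ≤ z := by
      rintro ⟨n, rfl⟩
      rcases le_or_gt n m with h | h
      · left
        have : (n : ℝ) ≤ m := by exact_mod_cast h
        exact mul_le_mul_of_nonneg_right this hupos.le
      · right
        have : (m : ℝ) + 1 ≤ n := by exact_mod_cast h
        exact mul_le_mul_of_nonneg_right this hupos.le
    rcases hmge with h | h
    · by_cases hze : (2 : ℝ) ^ e ≤ |z|
      · exact hmult (exists_eq_mul_of_le_abs hz (by rwa [sub_add_cancel]))
      · left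
        rw [not_le, hue] at hze
        have : (2 : ℝ) ^ p ≤ m := by exact_mod_cast h
        exact (le_abs_self z).trans (hze.le.trans (mul_le_mul_of_nonneg_right this hupos.le))
    · exact hmult (by rw [hu, h]; exact exists_eq_mul_min hz)
  obtain ⟨hF, hev⟩ := mem_Fset_of_normalized hp hm0 hmlt.le he1 he2 hmge
    (fun h ↦ absurd h hmlt.ne)
  by_cases hnear : w - m * u < (m + 1) * u - w
  · exact ⟨_, roundsTo_of_neighbours hab hmw hwm hF (.inl ⟨rfl, hnear⟩)⟩
  by_cases htie : w - m * u = (m + 1) * u - w ∧ 2 ∣ m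
  · exact ⟨_, roundsTo_of_neighbours hab hmw hwm hF
      (.inr (.inr ⟨.inl rfl, htie.1, hev htie.2⟩))⟩
  have hover : m + 1 = 2 ^ (p + 1) → e < emax q := by
    intro h
    by_contra hne
    obtain rfl : e = emax q := by omega
    have h' : (m : ℝ) = 2 ^ (p + 1) - 1 := by
      have : ((m + 1 : ℤ) : ℝ) = 2 ^ (p + 1) := by rw [h]; norm_num
      push_cast at this
      linarith
    rw [thr_eq, ← hu] at hw
    rw [h'] at hnear
    linarith
  obtain ⟨hF', hev'⟩ := mem_Fset_of_normalized (p := p) (q := q) (m := m + 1) hp (by omega)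
    (by omega) he1 he2 (hmge.imp_left (by omega)) hover
  push_cast at hF' hev'
  refine ⟨_, roundsTo_of_neighbours hab hmw hwm hF' (.inr ?_)⟩
  rw [not_lt] at hnear
  rcases hnear.lt_or_eq with h | h
  · exact .inl ⟨rfl, h⟩
  · refine .inr ⟨.inr rfl, h.symm, hev' ?_⟩
    have : ¬ 2 ∣ m := fun hd ↦ htie ⟨h.symm, hd⟩
    omega

lemma exists_roundsTo (hp : 0 < p) (hE : emin q ≤ emax q) {w : ℝ} (hw : |w| < thr p q) :
    ∃ y, RoundsTo p q w y := by
  rcases le_total 0 w with h | h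
  · exact exists_roundsTo_of_nonneg hp hE h ((le_abs_self w).trans_lt hw)
  · obtain ⟨y, hy⟩ := exists_roundsTo_of_nonneg hp hE (neg_nonneg.2 h)
      ((neg_le_abs w).trans_lt hw)
    exact ⟨-y, by simpa using hy.neg⟩

/-- `r` is a float nearest to `w`. -/
def Nearest (p q : ℕ) (w r : ℝ) : Prop := r ∈ Fset p q ∧ ∀ z ∈ Fset p q, |w - r| ≤ |w - z|

lemma Nearest.neg {w r : ℝ} (h : Nearest p q w r) : Nearest p q (-w) (-r) := by
  refine ⟨neg_mem_Fset h.1, fun z hz ↦ ?_⟩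
  have h1 := h.2 _ (neg_mem_Fset hz)
  rwa [← abs_neg, ← abs_neg (-w - z), show -(-w - -r) = w - r by ring,
    show -(-w - z) = w - -z by ring]

lemma Nearest.le {w r y : ℝ} (h : Nearest p q w r) (hy : y ∈ Fset p q) (hyw : y ≤ w) :
    y ≤ r := by
  by_contra! hry
  have h1 := h.2 y hy
  rw [abs_of_nonneg (by linarith), abs_of_nonneg (by linarith)] at h1
  linarith

lemma rnd_nearest (hp : 0 < p) (hE : emin q ≤ emax q) {w : ℝ} (hw : |w| < thr p q) :
    ∃ r, rnd p q w = .fin r ∧ Nearest p q w r := by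
  obtain ⟨h1, h2⟩ := abs_lt.1 hw
  have h := Classical.epsilon_spec (exists_roundsTo hp hE hw)
  exact ⟨_, by rw [rnd, if_neg h2.not_ge, if_neg h1.not_ge], h.1, h.2.1⟩

end Rounding

section RepeatedAddition

variable {p q : ℕ} {x : ℝ} {G : EF → EF}

/-- `G` adds the real number `x` to an extended float, rounding to a nearest float (with an
arbitrary rule for ties). -/
structure AddsConst (p q : ℕ) (x : ℝ) (G : EF → EF) : Prop where
  pinf : G .pinf = .pinf
  ninf : G .ninf = .ninf
  overflow : ∀ s ∈ Fset p q, thr p q ≤ s + x → G (.fin s) = .pinf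
  negOverflow : ∀ s ∈ Fset p q, s + x ≤ -thr p q → G (.fin s) = .ninf
  near : ∀ s ∈ Fset p q, |s + x| < thr p q → ∃ r, G (.fin s) = .fin r ∧ Nearest p q (s + x) r

lemma addsConst_fadd (hp : 0 < p) (hE : emin q ≤ emax q) (x : ℝ) :
    AddsConst p q x (fun a ↦ fadd p q a (.fin x)) where
  pinf := rfl
  ninf := rfl
  overflow s _ h := by
    change rnd p q (s + x) = _
    rw [rnd, if_pos h]
  negOverflow s _ h := by
    change rnd p q (s + x) = _
    have := thr_pos (p := p) hE
    rw [rnd, if_neg (by linarith), if_pos h]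
  near s _ h := rnd_nearest hp hE h

/-- Negation of extended floats. -/
def EF.neg : EF → EF
  | .fin x => .fin (-x)
  | .pinf => .ninf
  | .ninf => .pinf
  | .nan => .nan

lemma EF.neg_involutive : Function.Involutive EF.neg := by
  rintro (x | _ | _ | _) <;> simp [EF.neg]

lemma AddsConst.neg (h : AddsConst p q x G) :
    AddsConst p q (-x) (fun a ↦ (G a.neg).neg) where
  pinf := by simp [EF.neg, h.ninf]
  ninf := by simp [EF.neg, h.pinf]
  overflow s hs hsx := by
    simp [EF.neg, h.negOverflow (-s) (neg_mem_Fset hs) (by linarith)]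
  negOverflow s hs hsx := by
    simp [EF.neg, h.overflow (-s) (neg_mem_Fset hs) (by linarith)]
  near s hs hsx := by
    have hx : -s + x = -(s + -x) := by ring
    obtain ⟨r, h1, h2⟩ := h.near (-s) (neg_mem_Fset hs) (by rwa [hx, abs_neg])
    refine ⟨-r, by simp [EF.neg, h1], ?_⟩
    simpa [hx] using h2.neg

/-- A float that is strictly closer to `s + x` than every other float is a fixed point. -/
lemma AddsConst.fixed_of_gap (h : AddsConst p q x G) (hx : 0 ≤ x) {s : ℝ} (hs : s ∈ Fset p q)
    (hthr : s + x < thr p q) (hgap : ∀ y ∈ Fset p q, s < y → s + 2 * x < y) :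
    G (.fin s) = .fin s := by
  have h1 := (abs_lt.1 (abs_lt_thr hs)).1
  obtain ⟨r, hr, hn⟩ := h.near s hs (abs_lt.2 ⟨by linarith, hthr⟩)
  rw [hr]
  congr 1
  refine le_antisymm (not_lt.1 fun hlt ↦ ?_) (hn.le hs (by linarith))
  have h2 := hgap r hn.1 hlt
  have h3 := hn.2 s hs
  rw [abs_sub_comm, abs_of_nonneg (by linarith), abs_of_nonneg (by linarith)] at h3
  linarith

/-- The quantity that grows by at least one with every addition that has an effect; `t` is the
current sum in units of the leading power of two of the summand and `a = 2 ^ p`. -/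
noncomputable def progress (a t : ℝ) : ℝ :=
  max (-(2 * a)) (min (2 * a) ⌊t⌋) + (max (t - 2 * a) 0 + min (t + 2 * a) 0) / 2

lemma progress_mono (a : ℝ) : Monotone (progress a) := by
  intro s t h
  have : (⌊s⌋ : ℝ) ≤ ⌊t⌋ := by exact_mod_cast Int.floor_mono h
  unfold progress
  gcongr

lemma four_mul_le_of_progress {a t : ℝ} (ha : 0 < a) (h : 3 * a ≤ progress a t) : 4 * a ≤ t := by
  by_contra! hlt
  have h1 : max (-(2 * a)) (min (2 * a) (⌊t⌋ : ℝ)) ≤ 2 * a :=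
    max_le (by linarith) (min_le_left _ _)
  have h2 : max (t - 2 * a) 0 < 2 * a := max_lt (by linarith) (by linarith)
  have h3 : min (t + 2 * a) 0 ≤ 0 := min_le_right _ _
  unfold progress at h
  linarith

lemma le_progress {a t : ℝ} (ha : 0 < a) (h : -(4 * a) ≤ t) : -(3 * a) ≤ progress a t := by
  have h1 : -(2 * a) ≤ max (-(2 * a)) (min (2 * a) (⌊t⌋ : ℝ)) := le_max_left _ _
  have h2 : 0 ≤ max (t - 2 * a) 0 := le_max_right _ _
  have h3 : -(2 * a) ≤ min (t + 2 * a) 0 := le_min (by linarith) (by linarith)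
  unfold progress
  linarith

lemma progress_add_one_le_of_floor {a s t : ℝ} (h1 : -(2 * a) ≤ ⌊s⌋) (h2 : (⌊s⌋ : ℝ) + 1 ≤ 2 * a)
    (h : (⌊s⌋ : ℝ) + 1 ≤ t) : progress a s + 1 ≤ progress a t := by
  have hst : s ≤ t := (Int.lt_floor_add_one s).le.trans h
  have h3 : (⌊s⌋ : ℝ) + 1 ≤ ⌊t⌋ := by
    have : ⌊s⌋ + 1 ≤ ⌊t⌋ := Int.le_floor.2 (by exact_mod_cast h)
    exact_mod_cast this
  have h4 : max (-(2 * a)) (min (2 * a) (⌊s⌋ : ℝ)) = ⌊s⌋ := by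
    rw [min_eq_right (by linarith), max_eq_right h1]
  have h5 : (⌊s⌋ : ℝ) + 1 ≤ max (-(2 * a)) (min (2 * a) (⌊t⌋ : ℝ)) :=
    le_max_of_le_right (le_min h2 h3)
  have h6 : max (s - 2 * a) 0 ≤ max (t - 2 * a) 0 := max_le_max (by linarith) le_rfl
  have h7 : min (s + 2 * a) 0 ≤ min (t + 2 * a) 0 := min_le_min (by linarith) le_rfl
  unfold progress
  linarith

lemma progress_of_ge {a t : ℝ} (ha : 0 < a) {n : ℤ} (hn : (n : ℝ) = 2 * a) (h : 2 * a ≤ t) :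
    progress a t = t / 2 + a := by
  have h1 : 2 * a ≤ (⌊t⌋ : ℝ) := by
    rw [← hn]; exact_mod_cast Int.le_floor.2 (hn.trans_le h)
  have h2 : max (-(2 * a)) (2 * a) = 2 * a := max_eq_right (by linarith)
  have h3 : max (t - 2 * a) 0 = t - 2 * a := max_eq_left (by linarith)
  have h4 : min (t + 2 * a) 0 = 0 := min_eq_right (by linarith)
  rw [progress, min_eq_left h1, h2, h3, h4]
  ring

lemma progress_of_le {a t : ℝ} (ha : 0 < a) (h : t ≤ -(2 * a)) :
    progress a t = t / 2 - a := by
  have h1 : (⌊t⌋ : ℝ) ≤ t := Int.floor_le t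
  have h2 : max (-(2 * a)) (⌊t⌋ : ℝ) = -(2 * a) := max_eq_left (by linarith)
  have h3 : max (t - 2 * a) 0 = 0 := max_eq_right (by linarith)
  have h4 : min (t + 2 * a) 0 = t + 2 * a := min_eq_left (by linarith)
  rw [progress, min_eq_right (by linarith), h2, h3, h4]
  ring

lemma progress_add_one_le_of_outer {a s t : ℝ} (ha : 0 < a) {n : ℤ} (hn : (n : ℝ) = 2 * a)
    (h : 2 * a ≤ s ∨ s + 2 ≤ -(2 * a)) (hst : s + 2 ≤ t) : progress a s + 1 ≤ progress a t := by
  refine le_trans ?_ (progress_mono a hst)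
  rcases h with h | h
  · rw [progress_of_ge ha hn h, progress_of_ge ha hn (by linarith)]
    linarith
  · rw [progress_of_le ha (by linarith), progress_of_le ha h]
    linarith

lemma two_zpow_add_p_add (k : ℤ) (p j : ℕ) :
    (2 : ℝ) ^ (k + j + p) = 2 ^ j * 2 ^ p * 2 ^ k := by
  rw [two_zpow_eq_natPow_mul, two_zpow_eq_natPow_mul]; ring

lemma AddsConst.fixed_of_large (h : AddsConst p q x G) {k : ℤ} (hx0 : 0 < x)
    (hx : x < 2 ^ (k + 1)) {s : ℝ} (hs : s ∈ Fset p q)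
    (hlarge : (2 : ℝ) ^ (k + 2 + p) ≤ s ∨ s < -2 ^ (k + 2 + p)) : G (.fin s) = .fin s := by
  have h4 : (2 : ℝ) ^ (k + 2) = 2 * 2 ^ (k + 1) := by
    rw [← zpow_one_add₀ (by norm_num)]; congr 1; ring
  refine h.fixed_of_gap hx0.le hs ?_ fun y hy hsy ↦ ?_
  · have hpos := two_zpow_pos (k + 2 + p)
    have hle : (2 : ℝ) ^ (k + 2 + p) ≤ |s| := by
      rcases hlarge with h' | h'
      · exact h'.trans (le_abs_self s)
      · exact (lt_neg_of_lt_neg h').le.trans (neg_le_abs s)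
    have hlt := hle.trans_lt ((abs_lt_thr hs).trans_le (thr_le_two_zpow p q))
    have hk := (zpow_lt_zpow_iff_right₀ (by norm_num : (1 : ℝ) < 2)).1 hlt
    have hx' : x < 2 ^ (emax q - p - 1) := hx.trans_le (two_zpow_mono (by omega))
    have hO := (le_abs_self s).trans (abs_le_Omega hs)
    rw [thr]
    linarith
  · have := add_le_of_lt hs hy hlarge hsy
    linarith

lemma AddsConst.step (hE : emin q ≤ emax q) (h : AddsConst p q x G) {d : ℕ}
    (hx1 : (2 : ℝ) ^ (emin q - p + d) ≤ x) (hx2 : x < 2 ^ (emin q - p + d + 1)) {s : ℝ}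
    (hs : s ∈ Fset p q) :
    G (G (.fin s)) = G (.fin s) ∨ ∃ r ∈ Fset p q, G (.fin s) = .fin r ∧
      progress (2 ^ p) (s / 2 ^ (emin q - p + d)) + 1 ≤
        progress (2 ^ p) (r / 2 ^ (emin q - p + d)) := by
  set k : ℤ := emin q - p + d with hk
  have hu := two_zpow_pos k
  have hx0 : 0 < x := hu.trans_le hx1
  by_cases hfix : G (.fin s) = .fin s
  · left; rw [hfix, hfix]
  have h2 : (2 : ℝ) ^ (k + 2 + p) = 4 * 2 ^ p * 2 ^ k := by
    have := two_zpow_add_p_add k p 2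
    norm_num at this ⊢; exact this
  have h1 : (2 : ℝ) ^ (k + 1 + p) = 2 * 2 ^ p * 2 ^ k := by
    have := two_zpow_add_p_add k p 1
    norm_num at this ⊢; exact this
  have h1' : (2 : ℝ) ^ (k + 1) = 2 * 2 ^ k := by
    rw [← zpow_one_add₀ (by norm_num)]; congr 1; ring
  have hnl : ¬ ((2 : ℝ) ^ (k + 2 + p) ≤ s ∨ s < -2 ^ (k + 2 + p)) :=
    fun hl ↦ hfix (h.fixed_of_large hx0 hx2 hs hl)
  push Not at hnl
  by_cases hov : thr p q ≤ s + x
  · left; rw [h.overflow s hs hov, h.pinf]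
  have hlow := (abs_lt.1 (abs_lt_thr hs)).1
  obtain ⟨r, hr, hn⟩ := h.near s hs (abs_lt.2 ⟨by linarith, not_le.1 hov⟩)
  refine .inr ⟨r, hn.1, hr, ?_⟩
  have hsr : s < r := by
    refine lt_of_le_of_ne (hn.le hs (by linarith)) fun heq ↦ hfix ?_
    rw [hr, heq]
  have hcast : (((2 * 2 ^ p : ℤ)) : ℝ) = 2 * 2 ^ p := by push_cast; ring
  have ha : (0 : ℝ) < 2 ^ p := by positivity
  by_cases hout : (2 : ℝ) ^ (k + 1 + p) ≤ s ∨ s < -2 ^ (k + 1 + p)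
  · have hgap := add_le_of_lt hs hn.1 hout hsr
    refine progress_add_one_le_of_outer ha hcast ?_ ?_
    · rcases hout with h3 | h3
      · left
        rwa [le_div_iff₀ hu, ← h1]
      · right
        have hpos := two_zpow_pos (k + 1 + p)
        obtain ⟨n, hn'⟩ := exists_eq_mul_of_le_abs hs (i := k + 1)
          ((lt_neg_of_lt_neg h3).le.trans (neg_le_abs s))
        have h4 : -(2 : ℝ) ^ (k + 1 + p) = ((-2 ^ p : ℤ) : ℝ) * 2 ^ (k + 1) := by
          rw [two_zpow_eq_natPow_mul]; push_cast; ring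
        rw [h4, hn'] at h3
        have h5 := add_le_of_mul_lt (two_zpow_pos _) h3
        rw [← hn', ← h4, h1, h1'] at h5
        rw [← le_sub_iff_add_le, div_le_iff₀ hu]
        linarith
    · rw [← le_sub_iff_add_le, div_le_iff₀ hu, sub_mul, div_mul_cancel₀ _ hu.ne']
      linarith
  · push Not at hout
    obtain ⟨ho1, ho2⟩ := hout
    set N : ℤ := ⌊s / 2 ^ k⌋ with hN
    have hN1 : -(2 * 2 ^ p) ≤ N := by
      refine Int.le_floor.2 ?_
      rw [le_div_iff₀ hu]; push_cast; linarith
    have hN2 : N < 2 * 2 ^ p := by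
      refine Int.floor_lt.2 ?_
      rw [div_lt_iff₀ hu]; push_cast; linarith
    have hNs : N * 2 ^ k ≤ s := (le_div_iff₀ hu).1 (Int.floor_le _)
    have hsN : s < (N + 1) * 2 ^ k := (div_lt_iff₀ hu).1 (Int.lt_floor_add_one _)
    have hmem : ((N + 1 : ℤ) : ℝ) * 2 ^ k ∈ Fset p q := by
      rcases mul_mem_Fset_or_le_abs (p := p) hE d (N + 1)
        (by rw [pow_succ, abs_le]; constructor <;> linarith) with hm | hm
      · exact hm
      · exfalso
        rw [← hk] at hm
        have hm' := (thr_le_two_zpow p q).trans hm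
        push_cast at hm'
        rcases le_abs.1 hm' with h3 | h3 <;> linarith
    have hle := hn.le hmem (by push_cast; linarith)
    refine progress_add_one_le_of_floor (by exact_mod_cast hN1) (by exact_mod_cast hN2) ?_
    rw [le_div_iff₀ hu]
    exact_mod_cast hle

lemma AddsConst.iterate_fixed_of_pos (hE : emin q ≤ emax q) (h : AddsConst p q x G)
    (hx : x ∈ Fset p q) (hx0 : 0 < x) {s : ℝ} (hs : s ∈ Fset p q) :
    G (G^[6 * 2 ^ p] (.fin s)) = G^[6 * 2 ^ p] (.fin s) := by
  obtain ⟨k, hk1, hk2⟩ := exists_mem_Ico_zpow hx0 (by norm_num : (1 : ℝ) < 2)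
  obtain ⟨d, rfl⟩ : ∃ d : ℕ, k = emin q - p + d := by
    obtain ⟨n, hn⟩ := exists_eq_mul_min hx
    have hu := two_zpow_pos (emin q - p)
    have hn0 : (0 : ℝ) < n := pos_of_mul_pos_left (hn ▸ hx0) hu.le
    have hn1 : (1 : ℝ) ≤ n := by exact_mod_cast hn0
    have : (2 : ℝ) ^ (emin q - p) ≤ x := by rw [hn]; nlinarith
    have := (zpow_lt_zpow_iff_right₀ (by norm_num : (1 : ℝ) < 2)).1 (this.trans_lt hk2)
    exact ⟨(k - (emin q - p)).toNat, by omega⟩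
  set k : ℤ := emin q - p + d with hk
  have hu := two_zpow_pos k
  have ha : (0 : ℝ) < 2 ^ p := by positivity
  have h2 : (2 : ℝ) ^ (k + 2 + p) = 4 * 2 ^ p * 2 ^ k := by
    have := two_zpow_add_p_add k p 2
    norm_num at this ⊢; exact this
  have key : ∀ i : ℕ, G (G^[i] (.fin s)) = G^[i] (.fin s) ∨ ∃ r ∈ Fset p q,
      G^[i] (.fin s) = .fin r ∧ i - 3 * 2 ^ p ≤ progress (2 ^ p) (r / 2 ^ k) := by
    intro i
    induction i with
    | zero =>
      by_cases hl : s < -2 ^ (k + 2 + p)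
      · exact .inl (h.fixed_of_large hx0 hk2 hs (.inr hl))
      · refine .inr ⟨s, hs, rfl, ?_⟩
        have := le_progress ha (t := s / 2 ^ k) (by rw [le_div_iff₀ hu]; linarith)
        push_cast
        linarith
    | succ i ih =>
      rw [Function.iterate_succ_apply']
      rcases ih with ih | ⟨r, hr, hri, hpr⟩
      · left; rw [ih, ih]
      · rw [hri]
        rcases h.step hE hk1 hk2 hr with h3 | ⟨r', hr', h3, h4⟩
        · exact .inl h3
        · refine .inr ⟨r', hr', h3, ?_⟩
          push_cast
          linarith
  rcases key (6 * 2 ^ p) with h3 | ⟨r, hr, hri, hpr⟩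
  · exact h3
  · rw [hri]
    push_cast at hpr
    have := four_mul_le_of_progress ha (t := r / 2 ^ k) (by linarith)
    rw [le_div_iff₀ hu] at this
    exact h.fixed_of_large hx0 hk2 hr (.inl (by linarith))

lemma AddsConst.iterate_fixed (hE : emin q ≤ emax q) (h : AddsConst p q x G)
    (hx : x ∈ Fset p q) {s : ℝ} (hs : s ∈ Fset p q) :
    G (G^[6 * 2 ^ p] (.fin s)) = G^[6 * 2 ^ p] (.fin s) := by
  rcases lt_trichotomy x 0 with hx0 | rfl | hx0
  · have h1 := h.neg.iterate_fixed_of_pos hE (neg_mem_Fset hx) (neg_pos.2 hx0)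
      (neg_mem_Fset hs)
    have hsemi : Function.Semiconj EF.neg (fun a ↦ (G a.neg).neg) G :=
      fun a ↦ EF.neg_involutive _
    have h2 := congrArg EF.neg h1
    rw [hsemi.eq, (hsemi.iterate_right _).eq] at h2
    simpa [EF.neg] using h2
  · have hfix : G (.fin s) = .fin s :=
      h.fixed_of_gap le_rfl hs (by simpa using (le_abs_self s).trans_lt (abs_lt_thr hs))
        (by simp)
    rw [Function.iterate_fixed hfix, hfix]
  · exact h.iterate_fixed_of_pos hE hx hx0 hs

end RepeatedAddition

lemma foldl_replicate_eq_iterate {α β : Type*} (f : β → α → β) (x : α) (k : ℕ) (z : β) :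
    (List.replicate k x).foldl f z = (fun a ↦ f a x)^[k] z := by
  induction k generalizing z with
  | zero => rfl
  | succ k ih => rw [List.replicate_succ, List.foldl_cons, ih, Function.iterate_succ_apply]

/-- Unless both operands are finite, repeated addition of `x` is stationary after one step. -/
lemma fadd_fadd_of_not_finite {p q : ℕ} {z x : EF} (h : ¬ (z.Finite ∧ x.Finite)) :
    fadd p q (fadd p q z x) x = fadd p q z x := by
  cases z <;> cases x <;> simp_all [fadd, EF.Finite]

end FPT


/-- Lemma `same-sum2`. Starting from `z ∈ {0, ±∞, NaN} ∪ {±2^e}`,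
adding the same number `x` at least `6·2^p` times gives a result independent of the number
of additions. -/
theorem stmt11 (p q : ℕ) (hp : 2 ≤ p) (hpq : (p : ℤ) ≤ 2 ^ (q - 1) - 3)
    (x : FPT.EF) (hx : x.Valid p q) (z : FPT.EF)
    (hz : z = .fin 0 ∨ z = .pinf ∨ z = .ninf ∨ z = .nan ∨
      ∃ e : ℤ, ((2 : ℝ) ^ e ∈ FPT.Fset p q ∧
        (z = .fin ((2 : ℝ) ^ e) ∨ z = .fin (-((2 : ℝ) ^ e)))))
    (n m : ℕ) :
    (List.replicate (6 * 2 ^ p + n) x).foldl (FPT.fadd p q) z =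
      (List.replicate (6 * 2 ^ p + m) x).foldl (FPT.fadd p q) z := by
  have hE : FPT.emin q ≤ FPT.emax q := by
    have : (2 : ℤ) ≤ p := by exact_mod_cast hp
    unfold FPT.emin FPT.emax
    linarith
  set G : FPT.EF → FPT.EF := fun a ↦ FPT.fadd p q a x with hG
  suffices hfix : G (G^[6 * 2 ^ p] z) = G^[6 * 2 ^ p] z by
    simp only [FPT.foldl_replicate_eq_iterate, ← hG]
    rw [add_comm _ n, add_comm _ m, Function.iterate_add_apply, Function.iterate_add_apply,
      Function.iterate_fixed hfix, Function.iterate_fixed hfix]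
  by_cases hfin : z.Finite ∧ x.Finite
  · obtain ⟨hzf, hxf⟩ := hfin
    obtain ⟨s, rfl, hs⟩ : ∃ s, z = .fin s ∧ s ∈ FPT.Fset p q := by
      rcases hz with rfl | rfl | rfl | rfl | ⟨e, he, rfl | rfl⟩
      · exact ⟨0, rfl, FPT.zero_mem_Fset hE⟩
      · exact hzf.elim
      · exact hzf.elim
      · exact hzf.elim
      · exact ⟨_, rfl, he⟩
      · exact ⟨_, rfl, FPT.neg_mem_Fset he⟩
    cases x with
    | fin x => exact (FPT.addsConst_fadd (by omega) hE x).iterate_fixed hE hx hs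
    | pinf => exact hxf.elim
    | ninf => exact hxf.elim
    | nan => exact hxf.elim
  · have h1 : G (G z) = G z := FPT.fadd_fadd_of_not_finite hfin
    obtain ⟨k, hk⟩ : ∃ k, 6 * 2 ^ p = k + 1 :=
      Nat.exists_eq_add_one_of_ne_zero (by positivity)
    rw [hk, Function.iterate_succ_apply, Function.iterate_fixed h1, h1]
end

section
/- For any x ∈ 𝔽 and z ∈ 𝔽 ∪ {+∞} with x ≥ 0 and z ≥ 0, and for any n, m ∈ ℕ∪{0}, it holds that z ⊕ ⊕_{i=1}^{3·2^p−1+n} x = z ⊕ ⊕_{i=1}^{3·2^p−1+m} x (sums left-associative, z added first). Furthermore, z ⊕ ⊕_{i=1}^{3·2^p−1} x ∈ {0, z, z^+, +∞, −∞, NaN} ∪ ({2^e : e ∈ ℤ} ∩ 𝔽), and ⊕_{i=1}^{3·2^p−1} x ∈ {0, +∞, −∞, NaN} ∪ ({2^e : e ∈ ℤ} ∩ 𝔽). -/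
open scoped Classical

namespace FPT

/-- The digits `a` and the exponent `j` form the normalized representation of `a * 2 ^ j`, a
nonnegative float measured in multiples of the least positive float. -/
def Normalized (p a j : ℕ) : Prop := a < 2 ^ (p + 1) ∧ (2 ^ p ≤ a ∨ j = 0)

/-- Nonnegative floats without upper exponent bound, in multiples of the least positive float. -/
def IsNatFloat (p n : ℕ) : Prop := ∃ a j : ℕ, a ≤ 2 ^ (p + 1) ∧ n = a * 2 ^ j

/-- Rounding to nearest, ties to even, of a multiple of the least positive float, without upper
exponent bound. -/
def roundNat (p n : ℕ) : ℕ :=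
  let g := 2 ^ (Nat.log 2 n - p)
  if 2 * (n % g) < g ∨ (2 * (n % g) = g ∧ 2 ∣ n / g) then n / g * g else (n / g + 1) * g

theorem exists_normalized_decomposition (p n : ℕ) :
    ∃ a j r : ℕ, Normalized p a j ∧ r < 2 ^ j ∧ n = a * 2 ^ j + r := by
  refine ⟨n / 2 ^ (Nat.log 2 n - p), Nat.log 2 n - p, n % 2 ^ (Nat.log 2 n - p), ⟨?_, ?_⟩,
    Nat.mod_lt _ (by positivity), (Nat.div_add_mod' _ _).symm⟩
  · rw [Nat.div_lt_iff_lt_mul (by positivity), ← pow_add]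
    exact (Nat.lt_pow_succ_log_self one_lt_two n).trans_le
      (Nat.pow_le_pow_right (by norm_num) (by omega))
  · rcases le_or_gt (Nat.log 2 n) p with h | h
    · right; omega
    · left
      rw [Nat.le_div_iff_mul_le (by positivity), ← pow_add]
      have hn : n ≠ 0 := by rintro rfl; simp at h
      convert Nat.pow_log_le_self 2 hn using 2
      omega

theorem roundNat_eq {p a j r : ℕ} (h : Normalized p a j) (hr : r < 2 ^ j) :
    roundNat p (a * 2 ^ j + r) =
      if 2 * r < 2 ^ j ∨ (2 * r = 2 ^ j ∧ 2 ∣ a) then a * 2 ^ j else (a + 1) * 2 ^ j := by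
  have hlog : Nat.log 2 (a * 2 ^ j + r) - p = j := by
    have hub : a * 2 ^ j + r < 2 ^ (p + j + 1) := by
      calc a * 2 ^ j + r < (a + 1) * 2 ^ j := by rw [add_mul]; omega
        _ ≤ 2 ^ (p + 1) * 2 ^ j := Nat.mul_le_mul_right _ h.1
        _ = 2 ^ (p + j + 1) := by rw [← pow_add]; congr 1; omega
    have h1 : Nat.log 2 (a * 2 ^ j + r) < p + j + 1 := Nat.log_lt_of_lt_pow' (by omega) hub
    rcases h.2 with ha | rfl
    · have h2 : p + j ≤ Nat.log 2 (a * 2 ^ j + r) := by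
        apply Nat.le_log_of_pow_le one_lt_two
        rw [pow_add]
        exact (Nat.mul_le_mul_right _ ha).trans (Nat.le_add_right _ _)
      omega
    · omega
  have hdiv : (a * 2 ^ j + r) / 2 ^ j = a := by
    rw [mul_comm, Nat.mul_add_div (by positivity), Nat.div_eq_of_lt hr, add_zero]
  have hmod : (a * 2 ^ j + r) % 2 ^ j = r := by
    rw [mul_comm, Nat.mul_add_mod, Nat.mod_eq_of_lt hr]
  simp only [roundNat, hlog, hdiv, hmod]

theorem isNatFloat_two_pow (p k : ℕ) : IsNatFloat p (2 ^ k) :=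
  ⟨1, k, Nat.one_le_two_pow, by simp⟩

theorem Normalized.isNatFloat {p a j : ℕ} (h : Normalized p a j) : IsNatFloat p (a * 2 ^ j) :=
  ⟨a, j, h.1.le, rfl⟩

theorem Normalized.isNatFloat_succ {p a j : ℕ} (h : Normalized p a j) :
    IsNatFloat p ((a + 1) * 2 ^ j) :=
  ⟨a + 1, j, h.1, rfl⟩

/-- Consecutive floats of a binade have no float strictly between them. -/
theorem IsNatFloat.succ_mul_le {p c a j : ℕ} (hc : IsNatFloat p c) (h : Normalized p a j)
    (hlt : a * 2 ^ j < c) : (a + 1) * 2 ^ j ≤ c := by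
  obtain ⟨b, i, hb, rfl⟩ := hc
  rcases le_or_gt j i with hij | hij
  · obtain ⟨d, rfl⟩ := Nat.exists_eq_add_of_le hij
    have e : b * 2 ^ (j + d) = (b * 2 ^ d) * 2 ^ j := by rw [pow_add]; ring
    rw [e] at hlt ⊢
    exact Nat.mul_le_mul_right _ (Nat.lt_of_mul_lt_mul_right hlt)
  · exfalso
    obtain ⟨d, rfl⟩ := Nat.exists_eq_add_of_lt hij
    have ha : 2 ^ p ≤ a := h.2.resolve_right (by omega)
    have h1 : b * 2 ^ i ≤ 2 ^ (p + 1) * 2 ^ (i + d) :=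
      Nat.mul_le_mul hb (Nat.pow_le_pow_right (by norm_num) (by omega))
    have h2 : 2 ^ p * 2 ^ (i + d + 1) ≤ a * 2 ^ (i + d + 1) := Nat.mul_le_mul_right _ ha
    have h3 : 2 ^ p * 2 ^ (i + d + 1) = 2 ^ (p + 1) * 2 ^ (i + d) := by
      rw [← pow_add, ← pow_add]; congr 1; omega
    omega

theorem IsNatFloat.exists_normalized {p n : ℕ} (hn : IsNatFloat p n) :
    ∃ a j : ℕ, Normalized p a j ∧ n = a * 2 ^ j := by
  obtain ⟨a, j, r, h, hr, e⟩ := exists_normalized_decomposition p n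
  refine ⟨a, j, h, ?_⟩
  by_contra hne
  have := hn.succ_mul_le h (by omega)
  rw [add_mul] at this
  omega

theorem isNatFloat_roundNat (p n : ℕ) : IsNatFloat p (roundNat p n) := by
  obtain ⟨a, j, r, h, hr, rfl⟩ := exists_normalized_decomposition p n
  rw [roundNat_eq h hr]
  split_ifs
  exacts [h.isNatFloat, h.isNatFloat_succ]

theorem IsNatFloat.le_roundNat {p c n : ℕ} (hc : IsNatFloat p c) (hcn : c ≤ n) :
    c ≤ roundNat p n := by
  obtain ⟨a, j, r, h, hr, rfl⟩ := exists_normalized_decomposition p n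
  have hle : c ≤ a * 2 ^ j := by
    by_contra! hlt
    have := hc.succ_mul_le h hlt
    rw [add_mul] at this
    omega
  rw [roundNat_eq h hr]
  split_ifs
  · exact hle
  · exact hle.trans (Nat.mul_le_mul_right _ (Nat.le_succ a))

theorem IsNatFloat.roundNat_le {p c n : ℕ} (hc : IsNatFloat p c) (hnc : n ≤ c) :
    roundNat p n ≤ c := by
  obtain ⟨a, j, r, h, hr, rfl⟩ := exists_normalized_decomposition p n
  rw [roundNat_eq h hr]
  split_ifs with hif
  · omega
  · have : 0 < 2 ^ j := by positivity
    exact hc.succ_mul_le h (by omega)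

theorem IsNatFloat.roundNat_eq_self {p n : ℕ} (hn : IsNatFloat p n) : roundNat p n = n :=
  le_antisymm (hn.roundNat_le le_rfl) (hn.le_roundNat le_rfl)

/-- Numbers above the midpoint of two consecutive floats are rounded up. -/
theorem Normalized.succ_mul_le_roundNat {p a j n : ℕ} (h : Normalized p a j)
    (hn : 2 * (a * 2 ^ j) + 2 ^ j < 2 * n) : (a + 1) * 2 ^ j ≤ roundNat p n := by
  rcases le_or_gt ((a + 1) * 2 ^ j) n with hle | hlt
  · exact h.isNatFloat_succ.le_roundNat hle
  · rw [add_mul] at hlt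
    obtain ⟨r, rfl⟩ := Nat.exists_eq_add_of_le (show a * 2 ^ j ≤ n by omega)
    rw [roundNat_eq h (by omega), if_neg (by omega)]

theorem Normalized.exponent_ge {p a j k : ℕ} (h : Normalized p a j)
    (hk : 2 ^ (p + k) ≤ a * 2 ^ j) : k ≤ j := by
  by_contra! hlt
  have h1 : a * 2 ^ j < 2 ^ (p + 1) * 2 ^ j := Nat.mul_lt_mul_of_pos_right h.1 (by positivity)
  rw [← pow_add] at h1
  have h2 : 2 ^ (p + 1 + j) ≤ 2 ^ (p + k) := Nat.pow_le_pow_right (by norm_num) (by omega)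
  omega

theorem normalized_two_pow (p j : ℕ) : Normalized p (2 ^ p) j :=
  ⟨Nat.pow_lt_pow_right (by norm_num) (by omega), Or.inl le_rfl⟩

/-- The partial sums `z ⊕ x ⊕ ⋯ ⊕ x` with `k` summands `x`. -/
def orbit (p x z k : ℕ) : ℕ := (fun s => roundNat p (s + x))^[k] z

theorem orbit_succ (p x z k : ℕ) : orbit p x z (k + 1) = roundNat p (orbit p x z k + x) :=
  Function.iterate_succ_apply' _ _ _

theorem orbit_eq_of_fixed {p x z i k : ℕ}
    (h : roundNat p (orbit p x z i + x) = orbit p x z i) (hik : i ≤ k) :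
    orbit p x z k = orbit p x z i := by
  induction k, hik using Nat.le_induction with
  | base => rfl
  | succ k _ ih => rw [orbit_succ, ih, h]

theorem isNatFloat_orbit {p x z : ℕ} (hz : IsNatFloat p z) (k : ℕ) :
    IsNatFloat p (orbit p x z k) := by
  cases k with
  | zero => exact hz
  | succ k => rw [orbit_succ]; exact isNatFloat_roundNat _ _

/-- Multiples of `2 ^ e` bound the partial sums from below until the spacing exceeds `2 ^ e`. -/
theorem mul_two_pow_le_orbit {p x e : ℕ} (z : ℕ) (hx : 2 ^ e ≤ x) (k : ℕ)
    (hk : k ≤ 2 ^ (p + 1)) : k * 2 ^ e ≤ orbit p x z k := by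
  induction k with
  | zero => simp
  | succ k ih =>
    rw [orbit_succ]
    refine IsNatFloat.le_roundNat ⟨k + 1, e, hk, rfl⟩ ?_
    have := ih (by omega)
    rw [add_mul]
    omega

/-- If `x` exceeds `2 ^ e`, the partial sums stay ahead of the multiples of `2 ^ e` by one unit in
the last place. -/
theorem add_ulp_le_orbit {p x e : ℕ} (z : ℕ) (hxf : IsNatFloat p x) (hx : 2 ^ e < x)
    (k : ℕ) (hk1 : 1 ≤ k) : ∀ j, j ≤ p → 2 ^ j ≤ k → k < 2 ^ (j + 1) →
      k * 2 ^ e + 2 ^ (e + j - p) ≤ orbit p x z k := by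
  have hx' : 2 ^ e + 2 ^ (e - p) ≤ x := by
    rcases le_or_gt p e with h | h
    · have e1 : 2 ^ p * 2 ^ (e - p) = 2 ^ e := by rw [← pow_add]; congr 1; omega
      have := hxf.succ_mul_le (normalized_two_pow p (e - p)) (by rw [e1]; exact hx)
      rw [add_mul, e1] at this
      omega
    · rw [Nat.sub_eq_zero_of_le h.le, pow_zero]
      exact hx
  induction k, hk1 using Nat.le_induction with
  | base =>
    intro j _ h1 _
    have hj : j = 0 := by
      by_contra hj
      have := Nat.one_lt_two_pow hj
      omega
    subst hj
    have : x ≤ orbit p x z 1 := by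
      rw [orbit_succ]; exact hxf.le_roundNat (by omega)
    simpa using hx'.trans this
  | succ k hk1 ih =>
    intro j hj h1 h2
    rw [orbit_succ]
    rcases h1.eq_or_lt with heq | hlt
    · obtain ⟨i, rfl⟩ : ∃ i, j = i + 1 := by
        cases j with
        | zero => simp at heq; omega
        | succ i => exact ⟨i, rfl⟩
      have hi := ih i (by omega) (by rw [pow_succ] at heq; omega) (by omega)
      rw [← heq]
      have hsum : 2 ^ (i + 1) * 2 ^ e + 2 ^ (e + i - p) + 2 ^ (e - p) ≤ orbit p x z k + x := by
        rw [heq, add_mul, one_mul]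
        linarith
      have hpos : 0 < 2 ^ (e - p) := by positivity
      rcases le_or_gt (e + (i + 1)) p with hle | hgt
      · rw [Nat.sub_eq_zero_of_le (show e + i ≤ p by omega)] at hsum
        rw [Nat.sub_eq_zero_of_le hle]
        refine IsNatFloat.le_roundNat ⟨2 ^ (i + 1) * 2 ^ e + 2 ^ 0, 0, ?_, by simp⟩ (by omega)
        have h3 : 2 ^ (i + 1) * 2 ^ e ≤ 2 ^ p := by
          rw [← pow_add]; exact Nat.pow_le_pow_right (by norm_num) (by omega)
        have h4 : 0 < 2 ^ p := by positivity
        have h5 : 2 ^ (p + 1) = 2 * 2 ^ p := pow_succ' _ _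
        rw [h5, pow_zero]
        linarith
      · have e1 : 2 ^ p * 2 ^ (e + (i + 1) - p) = 2 ^ (i + 1) * 2 ^ e := by
          rw [← pow_add, ← pow_add]; congr 1; omega
        have e2 : 2 ^ (e + (i + 1) - p) = 2 * 2 ^ (e + i - p) := by
          rw [← pow_succ']; congr 1; omega
        have := (normalized_two_pow p (e + (i + 1) - p)).succ_mul_le_roundNat
          (n := orbit p x z k + x) (by rw [e1, e2]; omega)
        rwa [add_mul, e1, one_mul] at this
    · have hi := ih j hj (by omega) (by omega)
      have hsplit : 2 ^ e = 2 ^ (e - (e + j - p)) * 2 ^ (e + j - p) := by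
        rw [← pow_add]; congr 1; omega
      refine IsNatFloat.le_roundNat
        ⟨(k + 1) * 2 ^ (e - (e + j - p)) + 1, e + j - p, ?_, ?_⟩ (by rw [add_mul]; omega)
      · calc (k + 1) * 2 ^ (e - (e + j - p)) + 1
            ≤ (k + 1) * 2 ^ (e - (e + j - p)) + 2 ^ (e - (e + j - p)) := by
              gcongr; exact Nat.one_le_two_pow
          _ = (k + 1 + 1) * 2 ^ (e - (e + j - p)) := by ring
          _ ≤ 2 ^ (j + 1) * 2 ^ (e - (e + j - p)) := Nat.mul_le_mul_right _ h2
          _ ≤ 2 ^ (p + 1) := by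
              rw [← pow_add]; exact Nat.pow_le_pow_right (by norm_num) (by omega)
      · conv_lhs => rw [hsplit]
        ring

theorem add_mul_two_pow_le_orbit {p x e : ℕ} (z : ℕ) (hxf : IsNatFloat p x) (hx : 2 ^ e < x)
    (i : ℕ) (hi : i ≤ 2 ^ p) :
    (2 ^ p + i) * 2 ^ (e + 1) ≤ orbit p x z (2 ^ (p + 1) - 1 + i) := by
  have hp : 2 ^ (p + 1) = 2 * 2 ^ p := pow_succ' _ _
  have hp1 : 0 < 2 ^ p := by positivity
  have he : 2 ^ (e + 1) = 2 * 2 ^ e := pow_succ' _ _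
  induction i with
  | zero =>
    have := add_ulp_le_orbit z hxf hx (2 ^ (p + 1) - 1) (by omega) p le_rfl (by omega) (by omega)
    rw [Nat.add_sub_cancel] at this
    refine le_trans (le_of_eq ?_) this
    rw [← Nat.succ_mul, Nat.succ_eq_add_one, Nat.sub_add_cancel (by omega), hp, he]
    ring
  | succ i ih =>
    rw [← add_assoc, ← add_assoc, orbit_succ]
    have := ih (by omega)
    exact Normalized.succ_mul_le_roundNat ⟨by omega, Or.inl (by omega)⟩ (by omega)

theorem roundNat_two_pow_add {p x k : ℕ} (hp : 1 ≤ p) (hx : x ≤ 2 ^ k) :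
    roundNat p (2 ^ (p + 1 + k) + x) = 2 ^ (p + 1 + k) := by
  have e1 : 2 ^ (p + 1 + k) = 2 ^ p * 2 ^ (k + 1) := by rw [← pow_add]; congr 1; omega
  have e2 : 2 ^ (k + 1) = 2 * 2 ^ k := pow_succ' _ _
  have hpos : 0 < 2 ^ k := by positivity
  have hdvd : 2 ∣ 2 ^ p := dvd_pow_self 2 (by omega)
  rw [e1, roundNat_eq (normalized_two_pow p (k + 1)) (by omega), if_pos]
  rcases hx.eq_or_lt with rfl | h
  · exact Or.inr ⟨e2.symm, hdvd⟩
  · exact Or.inl (by omega)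

/-- A bound of the form `2 ^ (p + 1 + k)` cannot be crossed by adding a number at most the spacing
of the floats below it. -/
theorem orbit_le_two_pow {p x z k : ℕ} (hp : 1 ≤ p) (hz : IsNatFloat p z)
    (hzk : z ≤ 2 ^ (p + 1 + k)) (hx : x ≤ 2 ^ k) (n : ℕ) :
    orbit p x z n ≤ 2 ^ (p + 1 + k) := by
  induction n with
  | zero => exact hzk
  | succ n ih =>
    rw [orbit_succ]
    rcases ih.eq_or_lt with heq | hlt
    · rw [heq, roundNat_two_pow_add hp hx]
    · refine (isNatFloat_two_pow p _).roundNat_le ?_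
      have hpos : 0 < 2 ^ p := by positivity
      have e1 : 2 ^ (p + 1) = 2 * 2 ^ p := pow_succ' _ _
      have h : Normalized p (2 ^ (p + 1) - 1) k := ⟨by omega, Or.inl (by omega)⟩
      have e2 : (2 ^ (p + 1) - 1 + 1) * 2 ^ k = 2 ^ (p + 1 + k) := by
        rw [Nat.sub_add_cancel (by omega), ← pow_add]
      have hle : orbit p x z n ≤ (2 ^ (p + 1) - 1) * 2 ^ k := by
        by_contra! hgt
        have := (isNatFloat_orbit hz n).succ_mul_le h hgt
        omega
      rw [add_mul] at e2
      omega

/-- Adding `x` at most half an ulp of `z` moves `z` at most to the next float. -/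
theorem orbit_of_le_half_ulp {p x a j n : ℕ} (hp : 1 ≤ p) (h : Normalized p a j)
    (hx : 2 * x ≤ 2 ^ j) (hn : 1 ≤ n) :
    roundNat p (orbit p x (a * 2 ^ j) n + x) = orbit p x (a * 2 ^ j) n ∧
      (orbit p x (a * 2 ^ j) n = a * 2 ^ j ∨ orbit p x (a * 2 ^ j) n = (a + 1) * 2 ^ j) := by
  have hpos : 0 < 2 ^ j := by positivity
  have hround := roundNat_eq h (show x < 2 ^ j by omega)
  split_ifs at hround with hif
  · have := orbit_eq_of_fixed (i := 0) (p := p) (x := x) hround (Nat.zero_le n)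
    rw [this]
    exact ⟨hround, Or.inl rfl⟩
  · have h1 : orbit p x (a * 2 ^ j) 1 = (a + 1) * 2 ^ j := hround
    have hfix : roundNat p (orbit p x (a * 2 ^ j) 1 + x) = orbit p x (a * 2 ^ j) 1 := by
      rw [h1]
      have ha := h.1
      rcases (show a + 1 ≤ 2 ^ (p + 1) from ha).eq_or_lt with heq | hlt
      · rw [heq, ← pow_add]
        exact roundNat_two_pow_add hp (by omega)
      · have h' : Normalized p (a + 1) j := ⟨hlt, h.2.imp_left (by omega)⟩
        rw [roundNat_eq h' (by omega), if_pos (by omega)]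
    have := orbit_eq_of_fixed hfix hn
    rw [this]
    exact ⟨hfix, Or.inr h1⟩

theorem orbit_saturates {p x z : ℕ} (hp : 1 ≤ p) (hx : IsNatFloat p x) (hz : IsNatFloat p z) :
    roundNat p (orbit p x z (3 * 2 ^ p - 1) + x) = orbit p x z (3 * 2 ^ p - 1) ∧
      (orbit p x z (3 * 2 ^ p - 1) = z ∨
        (∃ a j, Normalized p a j ∧ z = a * 2 ^ j ∧
          orbit p x z (3 * 2 ^ p - 1) = (a + 1) * 2 ^ j) ∨
        ∃ e, orbit p x z (3 * 2 ^ p - 1) = 2 ^ e) := by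
  have hpos : 0 < 2 ^ p := by positivity
  have e1 : 2 ^ (p + 1) = 2 * 2 ^ p := pow_succ' _ _
  have key : ∃ k, x ≤ 2 ^ k ∧ (∃ i ≤ 3 * 2 ^ p - 1, 2 ^ (p + 1 + k) ≤ orbit p x z i) ∨ x = 0 := by
    rcases Nat.eq_zero_or_pos x with h0 | h0
    · exact ⟨0, Or.inr h0⟩
    rcases (Nat.pow_log_le_self 2 h0.ne').eq_or_lt with h | h
    · refine ⟨Nat.log 2 x, Or.inl ⟨h.ge, 2 ^ (p + 1), by omega, ?_⟩⟩
      rw [pow_add]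
      exact mul_two_pow_le_orbit z h.le _ le_rfl
    · refine ⟨Nat.log 2 x + 1, Or.inl ⟨(Nat.lt_pow_succ_log_self one_lt_two x).le,
        2 ^ (p + 1) - 1 + 2 ^ p, by omega, ?_⟩⟩
      have := add_mul_two_pow_le_orbit z hx h (2 ^ p) le_rfl
      rwa [← two_mul, ← e1, ← pow_add] at this
  obtain ⟨k, ⟨hxk, i, hi, hik⟩ | rfl⟩ := key
  · rcases le_or_gt z (2 ^ (p + 1 + k)) with hle | hgt
    · have heq := le_antisymm (orbit_le_two_pow hp hz hle hxk i) hik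
      have hfix : roundNat p (orbit p x z i + x) = orbit p x z i := by
        rw [heq, roundNat_two_pow_add hp hxk]
      rw [orbit_eq_of_fixed hfix hi]
      exact ⟨hfix, Or.inr (Or.inr ⟨_, heq⟩)⟩
    · obtain ⟨a, j, h, rfl⟩ := hz.exists_normalized
      have hj : k + 1 ≤ j := h.exponent_ge (by
        rw [show p + (k + 1) = p + 1 + k by omega]; exact hgt.le)
      have hkj : 2 ^ (k + 1) ≤ 2 ^ j := Nat.pow_le_pow_right (by norm_num) hj
      rw [pow_succ] at hkj
      obtain ⟨hfix, hval⟩ := orbit_of_le_half_ulp (n := 3 * 2 ^ p - 1) hp h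
        (show 2 * x ≤ 2 ^ j by omega) (by omega)
      exact ⟨hfix, hval.imp_right fun hs => Or.inl ⟨a, j, h, rfl, hs⟩⟩
  · have hfix : roundNat p (orbit p 0 z 0 + 0) = orbit p 0 z 0 := hz.roundNat_eq_self
    rw [orbit_eq_of_fixed hfix (Nat.zero_le _)]
    exact ⟨hfix, Or.inl rfl⟩

theorem Normalized.eq_of_mul_eq {p a i b j : ℕ} (ha : Normalized p a i) (hb : Normalized p b j)
    (h : a * 2 ^ i = b * 2 ^ j) : a = b := by
  have aux : ∀ {a i b j : ℕ}, Normalized p a i → Normalized p b j →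
      a * 2 ^ i = b * 2 ^ j → j ≤ i := by
    intro a i b j ha hb h
    by_contra! hlt
    obtain ⟨d, rfl⟩ := Nat.exists_eq_add_of_lt hlt
    have e : b * 2 ^ (i + d + 1) = b * 2 ^ (d + 1) * 2 ^ i := by ring
    rw [e] at h
    have h1 : a = b * 2 ^ (d + 1) := Nat.eq_of_mul_eq_mul_right (by positivity) h
    have h2 : 2 ^ p * 2 ^ 1 ≤ b * 2 ^ (d + 1) :=
      Nat.mul_le_mul (hb.2.resolve_right (by omega)) (Nat.pow_le_pow_right (by norm_num) (by omega))
    rw [← pow_add] at h2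
    have := ha.1
    omega
  obtain rfl : i = j := le_antisymm (aux hb ha h.symm) (aux ha hb h)
  exact Nat.eq_of_mul_eq_mul_right (by positivity) h

theorem Normalized.exponent_le {p a j J : ℕ} (h : Normalized p a j)
    (hlt : a * 2 ^ j < 2 ^ (p + 1 + J)) : j ≤ J := by
  rcases h.2 with ha | rfl
  · have h1 : 2 ^ p * 2 ^ j ≤ a * 2 ^ j := Nat.mul_le_mul_right _ ha
    rw [← pow_add] at h1
    have := (Nat.pow_lt_pow_iff_right one_lt_two).1 (h1.trans_lt hlt)
    omega
  · exact Nat.zero_le _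

theorem two_pow_le_roundNat_iff (p J n : ℕ) :
    2 ^ (p + 1 + J) ≤ roundNat p n ↔ 2 * 2 ^ (p + 1 + J) ≤ 2 * n + 2 ^ J := by
  have hpos : 0 < 2 ^ p := by positivity
  have hJ : 0 < 2 ^ J := by positivity
  have e1 : 2 ^ (p + 1) = 2 * 2 ^ p := pow_succ' _ _
  have h : Normalized p (2 ^ (p + 1) - 1) J := ⟨by omega, Or.inl (by omega)⟩
  have e2 : (2 ^ (p + 1) - 1 + 1) * 2 ^ J = 2 ^ (p + 1 + J) := by
    rw [Nat.sub_add_cancel (by omega), ← pow_add]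
  have e3 := e2
  rw [add_mul, one_mul] at e3
  rcases le_or_gt n ((2 ^ (p + 1) - 1) * 2 ^ J) with hle | hgt
  · have := h.isNatFloat.roundNat_le hle
    omega
  rcases le_or_gt (2 ^ (p + 1 + J)) n with hge | hlt
  · have := (isNatFloat_two_pow p _).le_roundNat hge
    omega
  obtain ⟨r, rfl⟩ := Nat.exists_eq_add_of_le hgt.le
  rw [roundNat_eq h (by omega), e2]
  split_ifs <;> omega

theorem mem_Fset_of_normalized_s12 {p q J a j : ℕ} (hJ : emax q = emin q + J)
    (h : Normalized p a j) (hj : j ≤ J) :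
    ((a * 2 ^ j : ℕ) : ℝ) * 2 ^ (emin q - p) ∈ Fset p q ∧
      (2 ∣ a → EvenMantissa p q (((a * 2 ^ j : ℕ) : ℝ) * 2 ^ (emin q - p))) := by
  have h1 : |(a : ℤ)| ≤ 2 ^ (p + 1) - 1 := by
    rw [Nat.abs_cast]
    have : (a : ℤ) < 2 ^ (p + 1) := by exact_mod_cast h.1
    omega
  have h2 : (2 : ℤ) ^ p ≤ |(a : ℤ)| ∨ emin q + j = emin q := by
    rw [Nat.abs_cast]
    exact h.2.imp (fun h => by exact_mod_cast h) (by rintro rfl; simp)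
  have h3 : ((a * 2 ^ j : ℕ) : ℝ) * 2 ^ (emin q - p) =
      ((a : ℤ) : ℝ) * (2 : ℝ) ^ (emin q + j - (p : ℤ)) := by
    rw [show emin q + j - (p : ℤ) = j + (emin q - p) by ring, zpow_add₀ two_ne_zero]
    push_cast
    rw [zpow_natCast]
    ring
  exact ⟨⟨a, emin q + j, h1, by omega, by omega, h2, h3⟩,
    fun he => ⟨a, emin q + j, h1, by omega, by omega, h2, h3, by exact_mod_cast he⟩⟩

theorem IsNatFloat.mem_Fset {p q J n : ℕ} (hJ : emax q = emin q + J) (hn : IsNatFloat p n)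
    (hlt : n < 2 ^ (p + 1 + J)) : (n : ℝ) * 2 ^ (emin q - p) ∈ Fset p q := by
  obtain ⟨a, j, h, rfl⟩ := hn.exists_normalized
  exact (mem_Fset_of_normalized_s12 hJ h (h.exponent_le hlt)).1

theorem exists_normalized_of_representation {p q J : ℕ} (hJ : emax q = emin q + J) {m e : ℤ}
    (h1 : |m| ≤ 2 ^ (p + 1) - 1) (h2 : emin q ≤ e) (h3 : e ≤ emax q)
    (h4 : (2 : ℤ) ^ p ≤ |m| ∨ e = emin q) :
    ∃ i ≤ J, Normalized p m.natAbs i ∧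
      (m : ℝ) * 2 ^ (e - (p : ℤ)) = ((m * 2 ^ i : ℤ) : ℝ) * 2 ^ (emin q - p) := by
  obtain ⟨i, rfl⟩ := Int.le.dest h2
  refine ⟨i, by omega, ⟨?_, ?_⟩, ?_⟩
  · zify
    omega
  · zify
    exact h4.imp_right (by omega)
  · rw [show emin q + i - (p : ℤ) = i + (emin q - p) by ring, zpow_add₀ two_ne_zero]
    push_cast
    rw [zpow_natCast]
    ring

theorem exists_int_of_mem_Fset {p q J : ℕ} (hJ : emax q = emin q + J) {y : ℝ}
    (hy : y ∈ Fset p q) :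
    ∃ c : ℤ, y = c * 2 ^ (emin q - p) ∧ IsNatFloat p c.natAbs ∧ c.natAbs < 2 ^ (p + 1 + J) := by
  obtain ⟨m, e, h1, h2, h3, h4, rfl⟩ := hy
  obtain ⟨i, hi, h, he⟩ := exists_normalized_of_representation hJ h1 h2 h3 h4
  have hnat : (m * 2 ^ i).natAbs = m.natAbs * 2 ^ i := by simp [Int.natAbs_mul, Int.natAbs_pow]
  refine ⟨m * 2 ^ i, he, hnat ▸ h.isNatFloat, ?_⟩
  rw [hnat, pow_add]
  exact Nat.mul_lt_mul_of_lt_of_le h.1 (Nat.pow_le_pow_right (by norm_num) hi) (by positivity)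

theorem exists_nat_of_mem_Fset {p q J : ℕ} (hJ : emax q = emin q + J) {y : ℝ}
    (hy : y ∈ Fset p q) (hy0 : 0 ≤ y) :
    ∃ c : ℕ, y = c * 2 ^ (emin q - p) ∧ IsNatFloat p c ∧ c < 2 ^ (p + 1 + J) := by
  obtain ⟨c, rfl, hc, hlt⟩ := exists_int_of_mem_Fset hJ hy
  have hU : (0 : ℝ) < 2 ^ (emin q - p) := by positivity
  have hc0 : 0 ≤ c := by exact_mod_cast nonneg_of_mul_nonneg_left hy0 hU
  obtain ⟨n, rfl⟩ := Int.eq_ofNat_of_zero_le hc0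
  exact ⟨n, by simp, hc, hlt⟩

theorem Normalized.two_dvd_of_evenMantissa {p q J a j : ℕ} (hJ : emax q = emin q + J)
    (h : Normalized p a j)
    (he : EvenMantissa p q (((a * 2 ^ j : ℕ) : ℝ) * 2 ^ (emin q - p))) : 2 ∣ a := by
  obtain ⟨m, e, h1, h2, h3, h4, h5, hdvd⟩ := he
  obtain ⟨i, -, hm, hrep⟩ := exists_normalized_of_representation hJ h1 h2 h3 h4
  rw [hrep] at h5
  have hU : (2 : ℝ) ^ (emin q - p) ≠ 0 := by positivity
  have h6 : ((a * 2 ^ j : ℕ) : ℤ) = m * 2 ^ i := by exact_mod_cast mul_right_cancel₀ hU h5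
  have h7 : a * 2 ^ j = m.natAbs * 2 ^ i := by
    rw [← Int.natAbs_natCast (a * 2 ^ j), h6]
    simp [Int.natAbs_mul, Int.natAbs_pow]
  rw [h.eq_of_mul_eq hm h7]
  omega

theorem Normalized.int_le_or_succ_mul_le {p a j : ℕ} (h : Normalized p a j) {c : ℤ}
    (hc : IsNatFloat p c.natAbs) :
    c ≤ ((a * 2 ^ j : ℕ) : ℤ) ∨ (((a + 1) * 2 ^ j : ℕ) : ℤ) ≤ c := by
  by_contra! hcon
  have := hc.succ_mul_le h (by omega)
  omega

theorem abs_natCast_mul_sub_intCast_mul {u : ℝ} (hu : 0 < u) (n : ℕ) (c : ℤ) :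
    |(n : ℝ) * u - c * u| = (((n : ℤ) - c).natAbs : ℝ) * u := by
  rw [← sub_mul, abs_mul, abs_of_pos hu, Nat.cast_natAbs]
  push_cast
  rfl

theorem roundsTo_iff {p q J : ℕ} (hp : 1 ≤ p) (hJ : emax q = emin q + J) {n : ℕ}
    (hlt : roundNat p n < 2 ^ (p + 1 + J)) (y : ℝ) :
    RoundsTo p q (n * 2 ^ (emin q - p)) y ↔ y = roundNat p n * 2 ^ (emin q - p) := by
  have hU : (0 : ℝ) < 2 ^ (emin q - p) := by positivity
  have hdist := abs_natCast_mul_sub_intCast_mul hU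
  obtain ⟨a, j, r, h, hr, hn⟩ := exists_normalized_decomposition p n
  have hround := roundNat_eq h hr
  rw [← hn] at hround
  have hmem := (isNatFloat_roundNat p n).mem_Fset hJ hlt
  have hsucc : (a + 1) * 2 ^ j = a * 2 ^ j + 2 ^ j := by ring
  have hpos : 0 < 2 ^ j := by positivity
  constructor
  · rintro ⟨hy, hnear, htie⟩
    obtain ⟨c, rfl, hc, -⟩ := exists_int_of_mem_Fset hJ hy
    have hle := hnear _ hmem
    rw [← Int.cast_natCast (roundNat p n), hdist, hdist, mul_le_mul_iff_left₀ hU,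
      Nat.cast_le] at hle
    have hgap := h.int_le_or_succ_mul_le hc
    by_contra hne
    have hcne : c ≠ (roundNat p n : ℤ) := by
      rintro rfl
      exact hne (by norm_cast)
    have htie' : ((n : ℤ) - roundNat p n).natAbs = ((n : ℤ) - c).natAbs := by
      split_ifs at hround <;> omega
    have heven : EvenMantissa p q (c * 2 ^ (emin q - p)) := by
      refine htie.resolve_left fun hu => hne (hu _ hmem ?_).symm
      rw [← Int.cast_natCast (roundNat p n), hdist, hdist, htie']
    split_ifs at hround with hif
    · obtain rfl : c = (((a + 1) * 2 ^ j : ℕ) : ℤ) := by omega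
      have hdvd : 2 ∣ a := by omega
      have hp2 : 2 ∣ 2 ^ (p + 1) := dvd_pow_self 2 (by omega)
      have ha := h.1
      have h' : Normalized p (a + 1) j := ⟨by omega, h.2.imp_left (by omega)⟩
      rw [Int.cast_natCast] at heven
      have := h'.two_dvd_of_evenMantissa hJ heven
      omega
    · obtain rfl : c = ((a * 2 ^ j : ℕ) : ℤ) := by omega
      rw [Int.cast_natCast] at heven
      have := h.two_dvd_of_evenMantissa hJ heven
      omega
  · rintro rfl
    refine ⟨hmem, ?_, ?_⟩
    · intro w hw
      obtain ⟨d, rfl, hd, -⟩ := exists_int_of_mem_Fset hJ hw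
      rw [← Int.cast_natCast (roundNat p n), hdist, hdist, mul_le_mul_iff_left₀ hU, Nat.cast_le]
      have := h.int_le_or_succ_mul_le hd
      split_ifs at hround <;> omega
    · by_cases hr2 : 2 * r = 2 ^ j
      · right
        split_ifs at hround with hif
        · rw [hround] at hlt ⊢
          exact (mem_Fset_of_normalized_s12 hJ h (h.exponent_le hlt)).2 (by omega)
        · rw [hround] at hlt ⊢
          have ha : a + 1 ≤ 2 ^ (p + 1) := h.1
          rcases ha.eq_or_lt with heq | hlt'
          · have e : (a + 1) * 2 ^ j = 2 ^ p * 2 ^ (j + 1) := by rw [heq]; ring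
            have h' := normalized_two_pow p (j + 1)
            rw [e] at hlt ⊢
            exact (mem_Fset_of_normalized_s12 hJ h' (h'.exponent_le hlt)).2
              (dvd_pow_self 2 (by omega))
          · have h' : Normalized p (a + 1) j := ⟨hlt', h.2.imp_left (by omega)⟩
            exact (mem_Fset_of_normalized_s12 hJ h' (h'.exponent_le hlt)).2 (by omega)
      · left
        intro w hw heq
        obtain ⟨d, rfl, hd, -⟩ := exists_int_of_mem_Fset hJ hw
        rw [← Int.cast_natCast (roundNat p n), hdist, hdist, mul_left_inj' hU.ne',
          Nat.cast_inj] at heq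
        have := h.int_le_or_succ_mul_le hd
        congr 1
        norm_cast
        split_ifs at hround <;> omega

/-- The extended float with value `n` times the least positive float, overflowing to `+∞`. -/
noncomputable def ofNatFloat (p q J n : ℕ) : EF :=
  if 2 ^ (p + 1 + J) ≤ n then .pinf else .fin (n * 2 ^ (emin q - p))

theorem two_mul_thr {p q J : ℕ} (hJ : emax q = emin q + J) :
    2 * thr p q = (2 * 2 ^ (p + 1 + J) - 2 ^ J) * 2 ^ (emin q - p) := by
  have h2 : (2 : ℝ) ≠ 0 := two_ne_zero
  have e1 : (2 : ℝ) ^ emax q = 2 ^ p * 2 ^ J * 2 ^ (emin q - p) := by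
    rw [← zpow_natCast, ← zpow_natCast, ← zpow_add₀ h2, ← zpow_add₀ h2, hJ]
    congr 1
    ring
  have e2 : (2 : ℝ) ^ (emax q - (p : ℤ) - 1) = 2 ^ J * 2 ^ (emin q - p) / 2 := by
    rw [zpow_sub_one₀ h2, zpow_sub₀ h2, e1, zpow_natCast]
    field_simp
  rw [thr, Omega, e1, e2, zpow_neg, zpow_natCast]
  field_simp
  ring

theorem rnd_natCast_mul {p q J : ℕ} (hp : 1 ≤ p) (hJ : emax q = emin q + J) (n : ℕ) :
    rnd p q (n * 2 ^ (emin q - p)) = ofNatFloat p q J (roundNat p n) := by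
  have hU : (0 : ℝ) < 2 ^ (emin q - p) := by positivity
  have hthr : thr p q ≤ n * 2 ^ (emin q - p) ↔ 2 ^ (p + 1 + J) ≤ roundNat p n := by
    rw [two_pow_le_roundNat_iff, ← mul_le_mul_iff_right₀ (two_pos (α := ℝ)), two_mul_thr hJ,
      ← mul_assoc, mul_le_mul_iff_left₀ hU, sub_le_iff_le_add]
    exact_mod_cast Iff.rfl
  have hneg : ¬ (n : ℝ) * 2 ^ (emin q - p) ≤ -thr p q := by
    have h1 : (0 : ℝ) ≤ n * 2 ^ (emin q - p) := by positivity
    have h2 : 0 < 2 * thr p q := by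
      rw [two_mul_thr hJ]
      have : (2 : ℝ) ^ J ≤ 2 ^ (p + 1 + J) := pow_le_pow_right₀ one_le_two (by omega)
      have h3 : (0 : ℝ) < 2 ^ J := by positivity
      exact mul_pos (by linarith) hU
    linarith
  rw [rnd, if_neg hneg, ofNatFloat]
  split_ifs with h1 h2 h2
  · rfl
  · exact absurd (hthr.1 h1) h2
  · exact absurd (hthr.2 h2) h1
  · congr 1
    have hiff := roundsTo_iff hp hJ (not_le.1 h2)
    exact (hiff _).1 (Classical.epsilon_spec ⟨_, (hiff _).2 rfl⟩)

theorem fadd_ofNatFloat {p q J : ℕ} (hp : 1 ≤ p) (hJ : emax q = emin q + J) (n x : ℕ) :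
    fadd p q (ofNatFloat p q J n) (.fin (x * 2 ^ (emin q - p))) =
      ofNatFloat p q J (roundNat p (n + x)) := by
  by_cases h : 2 ^ (p + 1 + J) ≤ n
  · have h' : 2 ^ (p + 1 + J) ≤ roundNat p (n + x) :=
      (isNatFloat_two_pow p _).le_roundNat (by omega)
    rw [ofNatFloat, ofNatFloat, if_pos h, if_pos h']
    rfl
  · rw [← rnd_natCast_mul hp hJ, ofNatFloat, if_neg h]
    simp only [fadd]
    push_cast
    rw [add_mul]

theorem foldl_replicate_ofNatFloat {p q J : ℕ} (hp : 1 ≤ p) (hJ : emax q = emin q + J)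
    (x k z : ℕ) :
    (List.replicate k (EF.fin (x * 2 ^ (emin q - p)))).foldl (fadd p q) (ofNatFloat p q J z) =
      ofNatFloat p q J (orbit p x z k) := by
  induction k generalizing z with
  | zero => rfl
  | succ k ih =>
    rw [List.replicate_succ, List.foldl_cons, fadd_ofNatFloat hp hJ, ih]
    rfl

theorem foldl_replicate_pinf (p q k : ℕ) (x : ℝ) :
    (List.replicate k (EF.fin x)).foldl (fadd p q) .pinf = .pinf := by
  induction k with
  | zero => rfl
  | succ k ih => exact ih

theorem succEF_fin_normalized {p q J a j : ℕ} (hJ : emax q = emin q + J)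
    (h : Normalized p a j) :
    succEF p q (.fin (((a * 2 ^ j : ℕ) : ℝ) * 2 ^ (emin q - p))) =
      ofNatFloat p q J ((a + 1) * 2 ^ j) := by
  have hU : (0 : ℝ) < 2 ^ (emin q - p) := by positivity
  have hnext : ∀ y ∈ Fset p q, ((a * 2 ^ j : ℕ) : ℝ) * 2 ^ (emin q - p) < y →
      ∃ c : ℕ, y = c * 2 ^ (emin q - p) ∧ (a + 1) * 2 ^ j ≤ c ∧ c < 2 ^ (p + 1 + J) := by
    intro y hy hlt
    obtain ⟨c, rfl, hc, hcJ⟩ := exists_nat_of_mem_Fset hJ hy (le_trans (by positivity) hlt.le)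
    exact ⟨c, rfl, hc.succ_mul_le h (by exact_mod_cast lt_of_mul_lt_mul_right hlt hU.le), hcJ⟩
  have hpos : 0 < 2 ^ j := by positivity
  rw [succEF, ofNatFloat]
  by_cases hle : 2 ^ (p + 1 + J) ≤ (a + 1) * 2 ^ j
  · rw [if_pos hle, if_neg]
    rintro ⟨y, hy, hlt⟩
    obtain ⟨c, -, h1, h2⟩ := hnext y hy hlt
    omega
  · have hmem := h.isNatFloat_succ.mem_Fset hJ (not_le.1 hle)
    have hlt : ((a * 2 ^ j : ℕ) : ℝ) * 2 ^ (emin q - p) <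
        (((a + 1) * 2 ^ j : ℕ) : ℝ) * 2 ^ (emin q - p) := by
      apply mul_lt_mul_of_pos_right _ hU
      rw [Nat.cast_lt, add_mul]
      omega
    rw [if_neg hle, if_pos ⟨_, hmem, hlt⟩]
    congr 1
    refine IsLeast.csInf_eq ⟨⟨hmem, hlt⟩, ?_⟩
    rintro y ⟨hy, hy'⟩
    obtain ⟨c, rfl, h1, -⟩ := hnext y hy hy'
    exact mul_le_mul_of_nonneg_right (by exact_mod_cast h1) hU.le

theorem ofNatFloat_two_pow {p q J : ℕ} (hJ : emax q = emin q + J) (k : ℕ) :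
    ofNatFloat p q J (2 ^ k) = .pinf ∨
      ∃ e : ℤ, (2 : ℝ) ^ e ∈ Fset p q ∧ ofNatFloat p q J (2 ^ k) = .fin (2 ^ e) := by
  rw [ofNatFloat]
  split_ifs with hle
  · exact Or.inl rfl
  · have hmem := (isNatFloat_two_pow p k).mem_Fset hJ (not_le.1 hle)
    have e : (2 : ℝ) ^ (k + (emin q - p)) = ((2 ^ k : ℕ) : ℝ) * 2 ^ (emin q - p) := by
      rw [zpow_add₀ two_ne_zero]
      push_cast
      rw [zpow_natCast]
    exact Or.inr ⟨k + (emin q - p), e ▸ hmem, by rw [e]⟩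

theorem ofNatFloat_of_lt {p q J n : ℕ} (h : n < 2 ^ (p + 1 + J)) :
    ofNatFloat p q J n = .fin (n * 2 ^ (emin q - p)) :=
  if_neg (not_le.2 h)

theorem fsuml_replicate {p q J x : ℕ} (hp : 1 ≤ p) (hJ : emax q = emin q + J)
    (hx : IsNatFloat p x) (hlt : x < 2 ^ (p + 1 + J)) {k : ℕ} (hk : 1 ≤ k) :
    fsuml p q (List.replicate k (EF.fin (x * 2 ^ (emin q - p)))) =
      ofNatFloat p q J (orbit p x 0 k) := by
  obtain ⟨k, rfl⟩ := Nat.exists_eq_add_of_le' hk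
  rw [← foldl_replicate_ofNatFloat hp hJ, List.replicate_succ, List.foldl_cons,
    fadd_ofNatFloat hp hJ, zero_add, hx.roundNat_eq_self, ofNatFloat_of_lt hlt]
  rfl

theorem exists_emax_eq_add {p q : ℕ} (hpq : (p : ℤ) ≤ 2 ^ (q - 1) - 3) :
    ∃ J : ℕ, emax q = emin q + J :=
  ⟨(emax q - emin q).toNat, by rw [emax, emin]; omega⟩

end FPT

/-- Lemma `same-sum1`. For nonnegative `x ∈ 𝔽` and `z ∈ 𝔽 ∪ {+∞}`
with `z ≥ 0`, the sums `z ⊕ ⊕_{i=1}^{3·2^p−1+n} x` are independent of `n`, and the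
saturated values have the stated forms. -/
theorem stmt12 (p q : ℕ) (hp : 2 ≤ p) (hpq : (p : ℤ) ≤ 2 ^ (q - 1) - 3)
    (x : ℝ) (hx : x ∈ FPT.Fset p q) (hx0 : 0 ≤ x)
    (z : FPT.EF)
    (hz : z = .pinf ∨ ∃ r : ℝ, r ∈ FPT.Fset p q ∧ 0 ≤ r ∧ z = .fin r) :
    (∀ n m : ℕ,
      (List.replicate (3 * 2 ^ p - 1 + n) (FPT.EF.fin x)).foldl (FPT.fadd p q) z =
        (List.replicate (3 * 2 ^ p - 1 + m) (FPT.EF.fin x)).foldl (FPT.fadd p q) z) ∧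
    ((List.replicate (3 * 2 ^ p - 1) (FPT.EF.fin x)).foldl (FPT.fadd p q) z = .fin 0 ∨
     (List.replicate (3 * 2 ^ p - 1) (FPT.EF.fin x)).foldl (FPT.fadd p q) z = z ∨
     (List.replicate (3 * 2 ^ p - 1) (FPT.EF.fin x)).foldl (FPT.fadd p q) z =
        FPT.succEF p q z ∨
     (List.replicate (3 * 2 ^ p - 1) (FPT.EF.fin x)).foldl (FPT.fadd p q) z = .pinf ∨
     (List.replicate (3 * 2 ^ p - 1) (FPT.EF.fin x)).foldl (FPT.fadd p q) z = .ninf ∨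
     (List.replicate (3 * 2 ^ p - 1) (FPT.EF.fin x)).foldl (FPT.fadd p q) z = .nan ∨
     ∃ e : ℤ, ((2 : ℝ) ^ e ∈ FPT.Fset p q ∧
       (List.replicate (3 * 2 ^ p - 1) (FPT.EF.fin x)).foldl (FPT.fadd p q) z =
          .fin ((2 : ℝ) ^ e))) ∧
    (FPT.fsuml p q (List.replicate (3 * 2 ^ p - 1) (FPT.EF.fin x)) = .fin 0 ∨
     FPT.fsuml p q (List.replicate (3 * 2 ^ p - 1) (FPT.EF.fin x)) = .pinf ∨
     FPT.fsuml p q (List.replicate (3 * 2 ^ p - 1) (FPT.EF.fin x)) = .ninf ∨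
     FPT.fsuml p q (List.replicate (3 * 2 ^ p - 1) (FPT.EF.fin x)) = .nan ∨
     ∃ e : ℤ, ((2 : ℝ) ^ e ∈ FPT.Fset p q ∧
       FPT.fsuml p q (List.replicate (3 * 2 ^ p - 1) (FPT.EF.fin x)) =
          .fin ((2 : ℝ) ^ e))) := by
  have hp1 : 1 ≤ p := by omega
  obtain ⟨J, hJ⟩ := FPT.exists_emax_eq_add hpq
  obtain ⟨x, rfl, hx, hxJ⟩ := FPT.exists_nat_of_mem_Fset hJ hx hx0
  have hN : 1 ≤ 3 * 2 ^ p - 1 := by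
    have : 0 < 2 ^ p := by positivity
    omega
  refine ⟨?_, ?_, ?_⟩
  · rcases hz with rfl | ⟨r, hr, hr0, rfl⟩
    · intro n m
      rw [FPT.foldl_replicate_pinf, FPT.foldl_replicate_pinf]
    · obtain ⟨z, rfl, hz, hzJ⟩ := FPT.exists_nat_of_mem_Fset hJ hr hr0
      have hfix := (FPT.orbit_saturates hp1 hx hz).1
      intro n m
      rw [← FPT.ofNatFloat_of_lt hzJ, FPT.foldl_replicate_ofNatFloat hp1 hJ,
        FPT.foldl_replicate_ofNatFloat hp1 hJ, FPT.orbit_eq_of_fixed hfix (Nat.le_add_right _ n),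
        FPT.orbit_eq_of_fixed hfix (Nat.le_add_right _ m)]
  · rcases hz with rfl | ⟨r, hr, hr0, rfl⟩
    · exact Or.inr (Or.inl (FPT.foldl_replicate_pinf _ _ _ _))
    · obtain ⟨z, rfl, hz, hzJ⟩ := FPT.exists_nat_of_mem_Fset hJ hr hr0
      have hfold := FPT.foldl_replicate_ofNatFloat hp1 hJ x (3 * 2 ^ p - 1) z
      rw [FPT.ofNatFloat_of_lt hzJ] at hfold
      rw [hfold]
      rcases (FPT.orbit_saturates hp1 hx hz).2 with h | ⟨a, j, h, rfl, hs⟩ | ⟨k, h⟩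
      · rw [h, FPT.ofNatFloat_of_lt hzJ]
        tauto
      · rw [hs, FPT.succEF_fin_normalized hJ h]
        tauto
      · rw [h]
        have := FPT.ofNatFloat_two_pow (p := p) hJ k
        tauto
  · rw [FPT.fsuml_replicate hp1 hJ hx hxJ hN]
    have h0 : FPT.IsNatFloat p 0 := ⟨0, 0, Nat.zero_le _, rfl⟩
    rcases (FPT.orbit_saturates hp1 hx h0).2 with h | ⟨a, j, h, h0, hs⟩ | ⟨k, h⟩
    · left
      rw [h, FPT.ofNatFloat_of_lt (by positivity)]
      simp
    · have ha : a = 0 := by simpa using h0.symm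
      subst ha
      rw [hs, zero_add, one_mul]
      have := FPT.ofNatFloat_two_pow (p := p) hJ j
      tauto
    · rw [h]
      have := FPT.ofNatFloat_two_pow (p := p) hJ k
      tauto
end

section
/- For any float x ∈ 𝔽 with 1 < x ≤ 2, there exist floats y, z ∈ 𝔽 with 2^{−1} < y ≤ 1 and 2^{−1} < z ≤ 1^+ such that x ⊗ y = 1^+ and x ⊗ z = 1^{++}. -/
open scoped Classical

namespace FPT

theorem mem_Fset_of_normalized_s13 {p q : ℕ} {m e : ℤ} (hm : 2 ^ p ≤ m) (hm' : m < 2 * 2 ^ p)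
    (he : emin q ≤ e) (he' : e ≤ emax q) : (m : ℝ) * 2 ^ e / 2 ^ p ∈ Fset p q := by
  have hP : (0 : ℤ) < 2 ^ p := by positivity
  have habs : |m| = m := abs_of_nonneg (by omega)
  refine ⟨m, e, ?_, he, he', .inl (habs.symm ▸ hm), ?_⟩
  · rw [habs, pow_succ]
    omega
  · rw [zpow_sub₀ two_ne_zero, zpow_natCast, mul_div_assoc]

/-- A float is either smaller than `1` in absolute value, or an integral multiple of `2^(-p)`. -/
theorem abs_lt_one_or_eq_div_of_mem_Fset {p q : ℕ} {x : ℝ} (hx : x ∈ Fset p q) :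
    |x| < 1 ∨ ∃ k : ℤ, x = k / 2 ^ p := by
  obtain ⟨m, e, hm, -, -, -, rfl⟩ := hx
  rw [zpow_sub₀ two_ne_zero, zpow_natCast]
  rcases lt_or_ge e 0 with he | he
  · left
    have hm' : |(m : ℝ)| < 2 * 2 ^ p := by
      have : |m| < 2 * 2 ^ p := by
        rw [pow_succ] at hm
        omega
      exact_mod_cast this
    have he' : (2 : ℝ) ^ e ≤ 1 / 2 := by
      calc (2 : ℝ) ^ e ≤ 2 ^ (-1 : ℤ) := zpow_le_zpow_right₀ one_le_two (by omega)
        _ = 1 / 2 := by norm_num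
    have hpos : (0 : ℝ) < 2 ^ e := by positivity
    rw [abs_mul, abs_of_pos (by positivity : (0 : ℝ) < 2 ^ e / 2 ^ p), ← mul_div_assoc,
      div_lt_one (by positivity)]
    nlinarith [mul_le_mul_of_nonneg_left he' (abs_nonneg (m : ℝ))]
  · right
    lift e to ℕ using he
    exact ⟨m * 2 ^ e, by push_cast; rw [zpow_natCast, mul_div_assoc]⟩

/-- Floats other than `t·2^(-p)` are at distance at least `2^(-p)` from it when `t > 2^p`. -/
theorem inv_le_abs_sub_of_mem_Fset {p q : ℕ} {t : ℤ} (ht : 2 ^ p < t) {z : ℝ}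
    (hz : z ∈ Fset p q) (hne : z ≠ t / 2 ^ p) : 1 / 2 ^ p ≤ |t / 2 ^ p - z| := by
  have hP : (0 : ℝ) < 2 ^ p := by positivity
  rcases abs_lt_one_or_eq_div_of_mem_Fset hz with h | ⟨k, rfl⟩
  · have ht' : (2 : ℝ) ^ p + 1 ≤ t := by exact_mod_cast ht
    have : 1 + 1 / 2 ^ p ≤ (t : ℝ) / 2 ^ p := by
      rw [le_div_iff₀ hP, add_mul, div_mul_cancel₀ _ hP.ne']
      linarith
    refine le_trans ?_ (le_abs_self _)
    linarith [(abs_lt.mp h).2]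
  · have hkt : t - k ≠ 0 := fun h => hne (by rw [sub_eq_zero.mp h])
    have : (1 : ℝ) ≤ |(t : ℝ) - k| := by exact_mod_cast Int.one_le_abs hkt
    rw [← sub_div, abs_div, abs_of_pos hP]
    gcongr

theorem lt_thr {p q : ℕ} (hq : 1 ≤ emax q) {r : ℝ} (hr : r < 2) : r < thr p q := by
  have hP : (2 : ℝ) ^ (-(p : ℤ)) ≤ 1 := zpow_le_one_of_nonpos₀ one_le_two (by simp)
  have hE : (2 : ℝ) ≤ 2 ^ emax q := by
    simpa using zpow_le_zpow_right₀ (one_le_two (α := ℝ)) hq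
  have hpos : (0 : ℝ) < 2 ^ (emax q - (p : ℤ) - 1) := by positivity
  unfold thr Omega
  nlinarith

theorem rnd_eq_of_abs_sub_lt {p q : ℕ} (hq : emin q ≤ 0) (hq' : 1 ≤ emax q) {t : ℤ}
    (ht : 2 ^ p < t) (ht' : t < 2 * 2 ^ p) {r : ℝ}
    (hr : |r - t / 2 ^ p| < 1 / (2 * 2 ^ p)) : rnd p q r = .fin (t / 2 ^ p) := by
  have hP : (0 : ℝ) < 2 ^ p := by positivity
  have hhalf : (1 : ℝ) / (2 * 2 ^ p) = (1 / 2 ^ p) / 2 := by field_simp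
  have hmem : (t : ℝ) / 2 ^ p ∈ Fset p q := by
    simpa using mem_Fset_of_normalized_s13 (p := p) (q := q) (e := 0) ht.le ht' hq (by omega)
  have hfar : ∀ z ∈ Fset p q, z ≠ t / 2 ^ p → |r - t / 2 ^ p| < |r - z| := fun z hz hne => by
    have h₁ := inv_le_abs_sub_of_mem_Fset ht hz hne
    have h₂ := abs_sub_le ((t : ℝ) / 2 ^ p) r z
    rw [abs_sub_comm _ r] at h₂
    linarith
  have hround : RoundsTo p q r (t / 2 ^ p) := by
    refine ⟨hmem, fun z hz => ?_, .inl fun z hz h => ?_⟩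
    · by_cases hne : z = t / 2 ^ p
      · rw [hne]
      · exact (hfar z hz hne).le
    · by_contra hne
      exact (hfar z hz hne).ne' h
  have heps : Classical.epsilon (RoundsTo p q r) = t / 2 ^ p := by
    obtain ⟨h₁, h₂, -⟩ := Classical.epsilon_spec ⟨_, hround⟩
    by_contra hne
    exact (hfar _ h₁ hne).not_ge (h₂ _ hmem)
  have hlow : (1 : ℝ) < t / 2 ^ p := by
    rw [one_lt_div hP]
    exact_mod_cast ht
  have hhigh : (t : ℝ) / 2 ^ p + 1 / 2 ^ p ≤ 2 := by
    rw [← add_div, div_le_iff₀ hP]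
    exact_mod_cast ht'
  have hinv : (1 : ℝ) / 2 ^ p ≤ 1 := div_le_one_of_le₀ (one_le_pow₀ one_le_two) hP.le
  have hinv' : (0 : ℝ) < 1 / 2 ^ p := by positivity
  rw [abs_lt] at hr
  have hthr : 0 < thr p q := lt_thr hq' two_pos
  rw [rnd, if_neg (lt_thr hq' (by linarith)).not_ge, if_neg (by linarith), heps]

theorem fmul_eq_of_int {p q : ℕ} (hq : emin q ≤ 0) (hq' : 1 ≤ emax q) {t a w : ℤ}
    (ht : 2 ^ p < t) (ht' : t < 2 * 2 ^ p) (h₁ : 2 * 2 ^ p * t - 2 ^ p < a * w)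
    (h₂ : a * w < 2 * 2 ^ p * t + 2 ^ p) :
    fmul p q (.fin (a / 2 ^ p)) (.fin (w / (2 * 2 ^ p))) = .fin (t / 2 ^ p) := by
  refine rnd_eq_of_abs_sub_lt hq hq' ht ht' ?_
  have hP : (0 : ℝ) < 2 ^ p := by positivity
  have h₁' : 2 * 2 ^ p * (t : ℝ) - 2 ^ p < a * w := by exact_mod_cast h₁
  have h₂' : (a : ℝ) * w < 2 * 2 ^ p * t + 2 ^ p := by exact_mod_cast h₂
  have heq : (a / 2 ^ p * (w / (2 * 2 ^ p)) - t / 2 ^ p : ℝ)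
      = (a * w - 2 * 2 ^ p * t) / (2 * 2 ^ p * 2 ^ p) := by
    field_simp
  rw [heq, abs_div, abs_of_pos (by positivity : (0 : ℝ) < 2 * 2 ^ p * 2 ^ p),
    div_lt_div_iff₀ (by positivity) (by positivity), one_mul]
  have : |(a * w - 2 * 2 ^ p * t : ℝ)| < 2 ^ p := abs_lt.mpr ⟨by linarith, by linarith⟩
  nlinarith

/-- Some multiple of `a` lies within less than `P` of `2 * P * t`. -/
theorem exists_mul_near {P a t : ℤ} (hP : 0 < P) (hPt : P < t) (ha : t ≤ a)
    (ha' : a ≤ 2 * P) :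
    ∃ w, P < w ∧ w ≤ 2 * P ∧ 2 * P * t - P < a * w ∧ a * w < 2 * P * t + P := by
  rcases ha'.eq_or_lt with rfl | hlt
  · exact ⟨t, hPt, ha, by linarith, by linarith⟩
  · have hapos : 0 < a := by linarith
    have h₁ := Int.mul_ediv_add_emod (2 * P * t - P) a
    have h₂ := Int.emod_nonneg (2 * P * t - P) hapos.ne'
    have h₃ := Int.emod_lt_of_pos (2 * P * t - P) hapos
    set d := (2 * P * t - P) / a
    refine ⟨d + 1, ?_, ?_, by linarith, by linarith⟩
    · by_contra! h
      nlinarith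
    · by_contra! h
      nlinarith

theorem div_two_mul_mem_Fset {p q : ℕ} (hq : emin q ≤ -1) (hq' : 0 ≤ emax q) {w : ℤ}
    (hw : 2 ^ p < w) (hw' : w ≤ 2 * 2 ^ p) : (w : ℝ) / (2 * 2 ^ p) ∈ Fset p q := by
  rcases hw'.eq_or_lt with rfl | hlt
  · have := mem_Fset_of_normalized_s13 (p := p) (q := q) (m := 2 ^ p) (e := 0) le_rfl
      (by linarith) (by omega) hq'
    convert this using 1
    push_cast
    field_simp
  · have := mem_Fset_of_normalized_s13 (p := p) (q := q) (e := -1) hw.le hlt hq (by omega)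
    convert this using 1
    rw [zpow_neg_one]
    field_simp

end FPT

/-- Lemma `one-plus`. For every float `x ∈ (1,2]` there are floats
`y ∈ (1/2, 1]` and `z ∈ (1/2, 1⁺]` with `x ⊗ y = 1⁺` and `x ⊗ z = 1⁺⁺`. -/
theorem stmt13 (p q : ℕ) (hp : 2 ≤ p) (hpq : (p : ℤ) ≤ 2 ^ (q - 1) - 3)
    (x : ℝ) (hx : x ∈ FPT.Fset p q) (hx1 : 1 < x) (hx2 : x ≤ 2) :
    ∃ y z : ℝ, y ∈ FPT.Fset p q ∧ z ∈ FPT.Fset p q ∧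
      (1 / 2 : ℝ) < y ∧ y ≤ 1 ∧
      (1 / 2 : ℝ) < z ∧ z ≤ 1 + 2 ^ (-(p : ℤ)) ∧
      FPT.fmul p q (.fin x) (.fin y) = .fin (1 + 2 ^ (-(p : ℤ))) ∧
      FPT.fmul p q (.fin x) (.fin z) = .fin (1 + 2 ^ ((1 : ℤ) - p)) := by
  have hq : FPT.emin q ≤ -1 := by unfold FPT.emin; omega
  have hq' : 1 ≤ FPT.emax q := by unfold FPT.emax; omega
  have hP4 : (4 : ℤ) ≤ 2 ^ p := by
    simpa using pow_le_pow_right₀ (one_le_two (α := ℤ)) hp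
  have hP : (0 : ℝ) < 2 ^ p := by positivity
  have hone : (1 + 2 ^ (-(p : ℤ)) : ℝ) = ((2 ^ p + 1 : ℤ) : ℝ) / 2 ^ p := by
    rw [zpow_neg, zpow_natCast]
    push_cast
    field_simp
  have htwo : (1 + 2 ^ ((1 : ℤ) - p) : ℝ) = ((2 ^ p + 2 : ℤ) : ℝ) / 2 ^ p := by
    rw [zpow_sub₀ two_ne_zero, zpow_natCast]
    push_cast
    field_simp
  obtain h | ⟨a, rfl⟩ := FPT.abs_lt_one_or_eq_div_of_mem_Fset hx
  · linarith [le_abs_self x]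
  have ha : 2 ^ p + 1 ≤ a := by
    rw [one_lt_div hP] at hx1
    exact_mod_cast hx1
  have ha' : a ≤ 2 * 2 ^ p := by
    rw [div_le_iff₀ hP] at hx2
    exact_mod_cast hx2
  have half_lt {w : ℤ} (hw : 2 ^ p < w) : (1 / 2 : ℝ) < w / (2 * 2 ^ p) := by
    have : (2 : ℝ) ^ p < w := by exact_mod_cast hw
    rw [div_lt_div_iff₀ two_pos (by positivity)]
    linarith
  have le_one {w : ℤ} (hw : w ≤ 2 * 2 ^ p) : (w / (2 * 2 ^ p) : ℝ) ≤ 1 := by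
    rw [div_le_one (by positivity)]
    exact_mod_cast hw
  obtain ⟨y, hy, hy', hay, hay'⟩ := FPT.exists_mul_near (by linarith) (by linarith) ha ha'
  have hz : ∃ z : ℤ, 2 ^ p < z ∧ (z / (2 * 2 ^ p) : ℝ) ∈ FPT.Fset p q ∧
      (z / (2 * 2 ^ p) : ℝ) ≤ 1 + 2 ^ (-(p : ℤ)) ∧
      2 * 2 ^ p * (2 ^ p + 2) - 2 ^ p < a * z ∧ a * z < 2 * 2 ^ p * (2 ^ p + 2) + 2 ^ p := by
    rcases ha.eq_or_lt with rfl | hlt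
    · have heq : (((2 * (2 ^ p + 1) : ℤ) : ℝ) / (2 * 2 ^ p)) = ((2 ^ p + 1 : ℤ) : ℝ) / 2 ^ p := by
        push_cast
        field_simp
      refine ⟨2 * (2 ^ p + 1), by linarith, ?_, by rw [heq, hone], by nlinarith, by nlinarith⟩
      rw [heq]
      simpa using FPT.mem_Fset_of_normalized_s13 (p := p) (q := q) (m := 2 ^ p + 1) (e := 0)
        (by linarith) (by linarith) (by omega) (by omega)
    · obtain ⟨z, hz, hz', haz, haz'⟩ := FPT.exists_mul_near (P := 2 ^ p) (t := 2 ^ p + 2)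
        (by linarith) (by linarith) (by linarith) ha'
      have hpos : (0 : ℝ) < 2 ^ (-(p : ℤ)) := by positivity
      exact ⟨z, hz, FPT.div_two_mul_mem_Fset hq (by omega) hz hz',
        by linarith [le_one hz'], haz, haz'⟩
  obtain ⟨z, hz, hzmem, hzle, haz, haz'⟩ := hz
  rw [hone] at hzle ⊢
  rw [htwo]
  exact ⟨y / (2 * 2 ^ p), z / (2 * 2 ^ p), FPT.div_two_mul_mem_Fset hq (by omega) hy hy', hzmem,
    half_lt hy, le_one hy', half_lt hz, hzle,
    FPT.fmul_eq_of_int (by omega) hq' (by linarith) (by linarith) hay hay',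
    FPT.fmul_eq_of_int (by omega) hq' (by linarith) (by linarith) haz haz'⟩
end
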